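/- arXiv:1707.03231 — 2 statements merged into one kernel-verified Lean document; each statement's English description precedes it below -/
import Mathlib

section
/- Let α be a rational number with α > e + 2(a₀+a₁+a₂)/3, let H be a height associated to −K_X + αF, set A = n+1+α−(a₀+a₁+a₂+e), and let U be a nonempty Zariski-open subset of X such that Δ(y) ≠ 0 and x₂ ≠ 0 at every point of U. Then for every ε > 0 there exists C_ε > 0 such that for every 𝐲 ∈ O_k^{n+1} with Δ(𝐲) ≠ 0 and y₀O_k + … + y_nO_k ∈ 𝒞, and every B > 0, N(X_y ∩ U, H, B)/B ≤ C_ε · ( H(y)^{−((a₀+a₁+a₂)/3 + A) + ε} + H(y)^{−(A+a₂) + ε} ), where y ∈ ℙⁿ(k) is the point with representative 𝐲 and X_y = π^{−1}(y). -/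
/-!
Setup (Frei–Loughran, "Rational points and non-anticanonical height functions",
§2–§3): `k` a number field, `X ⊂ F_n(a₀,a₁,a₂)` a smooth hypersurface of
bidegree `(e,2)` cut out by `Q(y,x) = ∑ f_{i,j}(y) xᵢ xⱼ`, with projection
`π : X → ℙⁿ`, discriminant `Δ(y) = det (f_{i,j}(y))`, and standard height `H*`
associated to the `ℚ`-divisor `-K_X + αF`.
-/

noncomputable section

open MvPolynomial NumberField Filter Topology IsDedekindDomain

namespace Stmt

variable (k : Type) [Field k] [NumberField k] (n : ℕ)

/-- A representative `(y, x)` of a `k`-rational point of the hypersurface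
`X : ∑_{i,j} f_{i,j}(y) xᵢxⱼ = 0` inside the bundle `F_n(a₀,a₁,a₂)`. -/
structure PtRep (f : Fin 3 → Fin 3 → MvPolynomial (Fin (n + 1)) (𝓞 k)) : Type where
  y : Fin (n + 1) → k
  x : Fin 3 → k
  hy : y ≠ 0
  hx : x ≠ 0
  hQ : ∑ i : Fin 3, ∑ j : Fin 3, (aeval y (f i j)) * x i * x j = 0

variable {k n}

/-- Two representatives give the same point of `F_n(a₀,a₁,a₂)(k)` iff they differ
by the action of `𝔾ₘ²`: `(λ,μ)·(y;x) = (λy; λ^{-a₀}μx₀, λ^{-a₁}μx₁, λ^{-a₂}μx₂)`. -/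
def ptRel (a : Fin 3 → ℤ) (f : Fin 3 → Fin 3 → MvPolynomial (Fin (n + 1)) (𝓞 k))
    (P P' : PtRep k n f) : Prop :=
  ∃ l m : kˣ, (∀ i, P'.y i = (l : k) * P.y i) ∧
    ∀ j, P'.x j = ((l ^ (-(a j)) * m : kˣ) : k) * P.x j

/-- The counting function `N(U, H, B)`: the number of points of `X(k)` lying in `U`
and of height at most `B`.  (Points of `X(k)` are classes of representatives.) -/
def Ncount (a : Fin 3 → ℤ) (f : Fin 3 → Fin 3 → MvPolynomial (Fin (n + 1)) (𝓞 k))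
    (U : Set (PtRep k n f)) (H : PtRep k n f → ℝ) (B : ℝ) : ℕ :=
  Nat.card {q : Quot (ptRel a f) // ∃ P, P ∈ U ∧ H P ≤ B ∧ Quot.mk (ptRel a f) P = q}

/-- `max_i |z i|_w` at an infinite place `w`. -/
def maxAt {ι : Type} [Fintype ι] [Nonempty ι] (w : InfinitePlace k) (z : ι → k) : ℝ :=
  Finset.univ.sup' Finset.univ_nonempty fun i => w (z i)

/-- The normalized absolute value `|z|_v^{m_v} = 𝔑(𝔭_v)^{-ord_v(z)}` attached to a
finite place (height-one prime) `v` of `k`. -/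
def fnorm (v : HeightOneSpectrum (𝓞 k)) (z : k) : ℝ :=
  if h : v.valuation k z = 0 then 0
  else (Ideal.absNorm v.asIdeal : ℝ) ^ (Multiplicative.toAdd (WithZero.unzero h))

/-- `max_i |z i|_v^{m_v}` at a finite place `v`. -/
def maxAtFin {ι : Type} [Fintype ι] [Nonempty ι] (v : HeightOneSpectrum (𝓞 k)) (z : ι → k) : ℝ :=
  Finset.univ.sup' Finset.univ_nonempty fun i => fnorm v (z i)

/-- The exponent `A = n + 1 + α - (a₀ + a₁ + a₂ + e)`. -/
def Aexp (n : ℕ) (a : Fin 3 → ℤ) (e : ℤ) (α : ℚ) : ℝ :=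
  (n : ℝ) + 1 + (α : ℝ) - (((a 0 : ℤ) : ℝ) + ((a 1 : ℤ) : ℝ) + ((a 2 : ℤ) : ℝ) + (e : ℝ))

/-- The standard height `H*(y;x) = ∏_v (max_i |y_i|_v^A · max_j (max_i |y_i|_v^{a_j} |x_j|_v))^{m_v}`
associated to the `ℚ`-divisor `-K_X + αF = M + AF`. -/
def Hstd (a : Fin 3 → ℤ) (e : ℤ) (α : ℚ)
    (f : Fin 3 → Fin 3 → MvPolynomial (Fin (n + 1)) (𝓞 k)) (P : PtRep k n f) : ℝ :=
  (∏ w : InfinitePlace k,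
      (maxAt w P.y ^ Aexp n a e α *
        Finset.univ.sup' Finset.univ_nonempty
          (fun j => maxAt w P.y ^ ((a j : ℤ) : ℝ) * w (P.x j))) ^ w.mult) *
  ∏ᶠ v : HeightOneSpectrum (𝓞 k),
      (maxAtFin v P.y ^ Aexp n a e α *
        Finset.univ.sup' Finset.univ_nonempty
          (fun j => maxAtFin v P.y ^ ((a j : ℤ) : ℝ) * fnorm v (P.x j)))

/-- The defining polynomial `Q = ∑_{i,j} f_{i,j}(y) xᵢxⱼ`, as a polynomial over `k`
  in the variables `y₀, …, y_n, x₀, x₁, x₂`. -/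
def Qk (f : Fin 3 → Fin 3 → MvPolynomial (Fin (n + 1)) (𝓞 k)) :
    MvPolynomial (Fin (n + 1) ⊕ Fin 3) k :=
  ∑ i : Fin 3, ∑ j : Fin 3,
    rename Sum.inl (map (algebraMap (𝓞 k) k) (f i j)) * X (Sum.inr i) * X (Sum.inr j)

/-- Smoothness of the hypersurface `X : Q = 0`: at every point over an algebraic
closure of `k` (with `y ≠ 0`, `x ≠ 0`) where `Q` vanishes, some partial derivative
of `Q` is nonzero. -/
def IsSmoothX (f : Fin 3 → Fin 3 → MvPolynomial (Fin (n + 1)) (𝓞 k)) : Prop :=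
  ∀ y : Fin (n + 1) → AlgebraicClosure k, ∀ x : Fin 3 → AlgebraicClosure k,
    y ≠ 0 → x ≠ 0 → aeval (Sum.elim y x) (Qk f) = 0 →
      ∃ s, aeval (Sum.elim y x) (pderiv s (Qk f)) ≠ 0

/-- The coefficients `f_{i,j}` are symmetric and homogeneous of degree `aᵢ + aⱼ + e`,
so that `Q` is bihomogeneous of bidegree `(e,2)` on `F_n(a₀,a₁,a₂)`. -/
def DegOK (a : Fin 3 → ℤ) (e : ℤ) (f : Fin 3 → Fin 3 → MvPolynomial (Fin (n + 1)) (𝓞 k)) : Prop :=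
  ∀ i j, f i j = f j i ∧ (f i j).IsHomogeneous (a i + a j + e).toNat ∧
    (a i + a j + e < 0 → f i j = 0)

/-- The discriminant `Δ(y) = det (f_{i,j}(y))`, evaluated at `y ∈ kⁿ⁺¹`. -/
def Deltak (f : Fin 3 → Fin 3 → MvPolynomial (Fin (n + 1)) (𝓞 k))
    (y : Fin (n + 1) → k) : k :=
  Matrix.det (Matrix.of fun i j => aeval y (f i j))

/-- A polynomial in the Cox ring of `F_n(a₀,a₁,a₂)` is bihomogeneous (of some bidegree
`(d₁,d₂)`) with respect to the `𝔾ₘ²`-action; the nonvanishing loci of such polynomials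
define the open subsets of `F_n(a₀,a₁,a₂)`. -/
def IsBihom (a : Fin 3 → ℤ) (g : MvPolynomial (Fin (n + 1) ⊕ Fin 3) k) : Prop :=
  ∃ (d₁ : ℤ) (d₂ : ℕ), ∀ (l m : kˣ) (y : Fin (n + 1) → k) (x : Fin 3 → k),
    eval (Sum.elim (fun i => (l : k) * y i) fun j => ((l ^ (-(a j)) * m : kˣ) : k) * x j) g =
      (l : k) ^ d₁ * (m : k) ^ d₂ * eval (Sum.elim y x) g

/-- The set of representatives of points of `X(k)` lying in the fibre `X_y = π⁻¹(y)`
above the point `y = (y₀ : ⋯ : y_n) ∈ ℙⁿ(k)`. -/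
def fiberSet (f : Fin 3 → Fin 3 → MvPolynomial (Fin (n + 1)) (𝓞 k))
    (y : Fin (n + 1) → k) : Set (PtRep k n f) :=
  {P | ∃ l : kˣ, ∀ i, P.y i = (l : k) * y i}

/-- The value `Δ(𝐲) = det (f_{i,j}(𝐲)) ∈ O_k` at an integral point `𝐲 ∈ O_kⁿ⁺¹`. -/
def DeltaO (f : Fin 3 → Fin 3 → MvPolynomial (Fin (n + 1)) (𝓞 k))
    (z : Fin (n + 1) → 𝓞 k) : 𝓞 k :=
  Matrix.det (Matrix.of fun i j => eval z (f i j))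

/-- The standard (absolute, multiplicative) projective height
`H(y) = ∏_v max_i |y_i|_v^{m_v}` of a point `y ∈ ℙⁿ(k)` given by a representative
`(y₀, …, y_n) ∈ kⁿ⁺¹ ∖ {0}` (well-defined by the product formula). -/
def Hproj {ι : Type} [Fintype ι] [Nonempty ι] (z : ι → k) : ℝ :=
  (∏ w : InfinitePlace k, maxAt w z ^ w.mult) * ∏ᶠ v : HeightOneSpectrum (𝓞 k), maxAtFin v z

theorem exists_pow_le_of_forall_prime_dvd (K : ℕ) : ∃ C : ℕ, 0 < C ∧ ∀ m n : ℕ, m ≠ 0 → n ≠ 0 →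
    (∀ q : ℕ, q.Prime → q ≤ n → q ∣ m) → n ^ K ≤ C * m := by
  induction K with
  | zero => exact ⟨1, one_pos, fun m n hm _ _ => by simpa using Nat.one_le_iff_ne_zero.2 hm⟩
  | succ K ih =>
    obtain ⟨C, hC, h⟩ := ih
    refine ⟨3 ^ (K + 1) * C, by positivity, fun m n hm hn hq => ?_⟩
    rcases Nat.lt_or_ge n 2 with h2 | h2
    · obtain rfl : n = 1 := by omega
      simpa using Nat.one_le_iff_ne_zero.2 (mul_ne_zero (by positivity) hm)
    obtain ⟨q, hqp, hq1, hq2⟩ := Nat.exists_prime_lt_and_le_two_mul (n / 2) (by omega)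
    obtain ⟨m', rfl⟩ := hq q hqp (by omega)
    have hm' : m' ≠ 0 := by rintro rfl; simp at hm
    have key := h m' (n / 2) hm' (by omega) fun q' hq' hle => by
      refine (Nat.Coprime.dvd_mul_left ?_).1 (hq q' hq' (by omega))
      exact (Nat.coprime_primes hq' hqp).2 (by omega)
    calc n ^ (K + 1) ≤ (3 * (n / 2)) ^ (K + 1) := Nat.pow_le_pow_left (by omega) _
      _ = 3 ^ (K + 1) * ((n / 2) ^ K * (n / 2)) := by ring
      _ ≤ 3 ^ (K + 1) * ((C * m') * q) := by gcongr
      _ = 3 ^ (K + 1) * C * (q * m') := by ring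

/-- A nonzero integer `m` avoids some prime which is small compared to `m`. -/
theorem exists_prime_not_dvd_pow_le (K : ℕ) : ∃ C : ℕ, 0 < C ∧ ∀ m : ℕ, m ≠ 0 →
    ∃ p : ℕ, p.Prime ∧ ¬ p ∣ m ∧ p ^ K ≤ C * m := by
  obtain ⟨C, hC, h⟩ := exists_pow_le_of_forall_prime_dvd K
  refine ⟨2 ^ K * C, by positivity, fun m hm => ?_⟩
  have hex : ∃ p : ℕ, p.Prime ∧ ¬ p ∣ m := by
    obtain ⟨p, hp, hpp⟩ := Nat.exists_infinite_primes (m + 1)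
    exact ⟨p, hpp, fun hd => by have := Nat.le_of_dvd (by omega) hd; omega⟩
  classical
  obtain ⟨hp, hpm⟩ := Nat.find_spec hex
  refine ⟨Nat.find hex, hp, hpm, ?_⟩
  have h2 := hp.two_le
  have key := h m (Nat.find hex - 1) hm (by omega) fun q hq hle => by
    by_contra hqm
    exact Nat.find_min hex (by omega) ⟨hq, hqm⟩
  calc (Nat.find hex) ^ K ≤ (2 * (Nat.find hex - 1)) ^ K := Nat.pow_le_pow_left (by omega) _
    _ = 2 ^ K * (Nat.find hex - 1) ^ K := by ring
    _ ≤ 2 ^ K * (C * m) := by gcongr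
    _ = 2 ^ K * C * m := by ring

theorem natCard_le_two_mul {T F : Type*} [Fintype F] (Φ : T → F)
    (h : ∀ t : Fin 3 → T, (∀ i j, Φ (t i) = Φ (t j)) → ∃ i j, i ≠ j ∧ t i = t j) :
    Nat.card T ≤ 2 * Fintype.card F := by
  classical
  rcases finite_or_infinite T with hT | hT
  · have := Fintype.ofFinite T
    rw [Nat.card_eq_fintype_card, ← Finset.card_univ, ← Finset.card_univ (α := F)]
    refine Finset.card_le_mul_card_image_of_maps_to (f := Φ) (fun _ _ => Finset.mem_univ _) 2 ?_
    intro b _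
    by_contra! hlt
    obtain ⟨x, y, z, hx, hy, hz, hxy, hxz, hyz⟩ := Finset.two_lt_card_iff.1 hlt
    simp only [Finset.mem_filter, Finset.mem_univ, true_and] at hx hy hz
    obtain ⟨i, j, hij, he⟩ := h ![x, y, z] (by
      intro i j; fin_cases i <;> fin_cases j <;> simp [hx, hy, hz])
    fin_cases i <;> fin_cases j <;> simp_all
  · simp

section Conic

open Matrix

variable {R : Type*} [CommRing R] {M : Matrix (Fin 3) (Fin 3) R}

theorem dotProduct_mulVec_comm_of_isSymm (hM : M.IsSymm) (x y : Fin 3 → R) :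
    x ⬝ᵥ M *ᵥ y = y ⬝ᵥ M *ᵥ x := by
  rw [dotProduct_mulVec, dotProduct_comm, ← mulVec_transpose, hM.eq]

theorem mul_mul_transpose_apply_eq (x : Matrix (Fin 3) (Fin 3) R) (i j : Fin 3) :
    (x * M * xᵀ) i j = x i ⬝ᵥ M *ᵥ x j := by
  rw [Matrix.mul_assoc]; rfl

theorem det_mul_mul_transpose_eq (x : Matrix (Fin 3) (Fin 3) R) :
    (x * M * xᵀ).det = x.det ^ 2 * M.det := by
  rw [det_mul, det_mul, det_transpose]; ring

theorem two_mul_gram_eq (hM : M.IsSymm) (x : Matrix (Fin 3) (Fin 3) R)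
    (hx : ∀ i, x i ⬝ᵥ M *ᵥ x i = 0) :
    2 * (x 0 ⬝ᵥ M *ᵥ x 1) * (x 0 ⬝ᵥ M *ᵥ x 2) * (x 1 ⬝ᵥ M *ᵥ x 2) = x.det ^ 2 * M.det := by
  rw [← det_mul_mul_transpose_eq, det_fin_three]
  simp only [mul_mul_transpose_apply_eq, hx, dotProduct_mulVec_comm_of_isSymm hM (x 1) (x 0),
    dotProduct_mulVec_comm_of_isSymm hM (x 2) (x 0),
    dotProduct_mulVec_comm_of_isSymm hM (x 2) (x 1)]
  ring

theorem proportional_of_isotropic [IsDomain R] (hM : M.IsSymm) (hdet : M.det ≠ 0) {x y : Fin 3 → R}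
    (hxx : x ⬝ᵥ M *ᵥ x = 0) (hyy : y ⬝ᵥ M *ᵥ y = 0) (hxy : x ⬝ᵥ M *ᵥ y = 0) (i j : Fin 3) :
    x i * y j = x j * y i := by
  have key : ∀ w, (Matrix.of ![x, y, w]).det = 0 := fun w => by
    have hd := det_mul_mul_transpose_eq (M := M) (Matrix.of ![x, y, w])
    have h0 : (Matrix.of ![x, y, w] * M * (Matrix.of ![x, y, w])ᵀ).det = 0 := by
      rw [det_fin_three]
      have e0 : Matrix.of ![x, y, w] 0 = x := rfl
      have e1 : Matrix.of ![x, y, w] 1 = y := rfl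
      simp only [mul_mul_transpose_apply_eq, e0, e1, hxx, hyy, hxy,
        dotProduct_mulVec_comm_of_isSymm hM y x]
      ring
    rw [h0] at hd
    have := (mul_eq_zero.1 hd.symm).resolve_right hdet
    exact pow_eq_zero_iff two_ne_zero |>.1 this
  have h0 := key ![1, 0, 0]
  have h1 := key ![0, 1, 0]
  have h2 := key ![0, 0, 1]
  simp [det_fin_three] at h0 h1 h2
  fin_cases i <;> fin_cases j <;> simp <;>
    first
    | ring
    | linear_combination h0
    | linear_combination -h0
    | linear_combination h1
    | linear_combination -h1
    | linear_combination h2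
    | linear_combination -h2

/-- A line meets a nonsingular conic in at most two points. -/
theorem exists_proportional_of_det_eq_zero [IsDomain R] (h2 : (2 : R) ≠ 0) (hM : M.IsSymm)
    (hdet : M.det ≠ 0) (x : Matrix (Fin 3) (Fin 3) R) (hx : ∀ i, x i ⬝ᵥ M *ᵥ x i = 0)
    (h0 : x.det = 0) : ∃ i j, i ≠ j ∧ ∀ a b, x i a * x j b = x i b * x j a := by
  have := two_mul_gram_eq hM x hx
  simp only [h0, ne_eq, OfNat.ofNat_ne_zero, not_false_eq_true, zero_pow, zero_mul, mul_eq_zero,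
    h2, false_or] at this
  rcases this with (h | h) | h
  · exact ⟨0, 1, by decide, proportional_of_isotropic hM hdet (hx _) (hx _) h⟩
  · exact ⟨0, 2, by decide, proportional_of_isotropic hM hdet (hx _) (hx _) h⟩
  · exact ⟨1, 2, by decide, proportional_of_isotropic hM hdet (hx _) (hx _) h⟩

theorem dotProduct_mem_mul {I J : Ideal R} {x y : Fin 3 → R} (hx : ∀ a, x a ∈ I)
    (hy : ∀ a, y a ∈ J) : x ⬝ᵥ y ∈ I * J :=
  Ideal.sum_mem _ fun a _ => Ideal.mul_mem_mul (hx a) (hy a)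

theorem mulVec_mem {J : Ideal R} {y : Fin 3 → R} (hy : ∀ a, y a ∈ J) (a : Fin 3) :
    (M *ᵥ y) a ∈ J :=
  Ideal.sum_mem (t := Finset.univ) _ fun b _ => Ideal.mul_mem_left _ (M a b) (hy b)

theorem exists_mulVec_notMem {q : Ideal R} [hq : q.IsPrime] (hdet : M.det ∉ q) {y : Fin 3 → R}
    (hy : y ⬝ᵥ M *ᵥ y = 0) {j : Fin 3} (hj : y j ∉ q) : ∃ l, l ≠ j ∧ (M *ᵥ y) l ∉ q := by
  by_contra! h
  have hjq : (M *ᵥ y) j ∈ q := by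
    have hs : y j * (M *ᵥ y) j ∈ q := by
      have : y j * (M *ᵥ y) j = -∑ l ∈ Finset.univ.erase j, y l * (M *ᵥ y) l := by
        rw [dotProduct, ← Finset.add_sum_erase _ _ (Finset.mem_univ j)] at hy
        linear_combination hy
      rw [this]
      exact q.neg_mem (Ideal.sum_mem _ fun l hl => q.mul_mem_left _ (h l (Finset.ne_of_mem_erase hl)))
    exact (hq.mem_or_mem hs).resolve_left hj
  have hall : ∀ l, (M *ᵥ y) l ∈ q := fun l => by
    by_cases hl : l = j
    · exact hl ▸ hjq
    · exact h l hl
  have hadj : M.det * y j = (M.adjugate *ᵥ (M *ᵥ y)) j := by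
    rw [mulVec_mulVec, adjugate_mul, smul_mulVec, one_mulVec]; rfl
  have : M.det * y j ∈ q := hadj ▸ mulVec_mem hall j
  exact (hq.mem_or_mem this).elim hdet hj

variable [IsDedekindDomain R]

/-- Hensel-type uniqueness: a point of the conic is determined modulo `q ^ r` by its class
modulo `q` and by all but one suitable coordinate modulo `q ^ r`. -/
theorem sub_mem_pow_of_isotropic {q : Ideal R} [hq : q.IsPrime] (h2 : (2 : R) ∉ q)
    (hM : M.IsSymm) {y y' : Fin 3 → R}
    (hy : y ⬝ᵥ M *ᵥ y = 0) (hy' : y' ⬝ᵥ M *ᵥ y' = 0) {l : Fin 3} {r : ℕ}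
    (hl : (M *ᵥ y) l ∉ q) (hq1 : y' l - y l ∈ q) (hqr : ∀ a, a ≠ l → y' a - y a ∈ q ^ r) (a : Fin 3) :
    y' a - y a ∈ q ^ r := by
  by_cases ha : a ≠ l
  · exact hqr a ha
  obtain rfl : a = l := by simpa using ha
  set t := y' a - y a with ht
  set u := y + Pi.single a t with hu
  set g := y' - u with hg
  have hgm : ∀ b, g b ∈ q ^ r := fun b => by
    by_cases hb : b = a
    · subst hb; simp [hg, hu, ht]
    · simpa [hg, hu, hb] using hqr b hb
  have hu1 : u ⬝ᵥ M *ᵥ u = t * (2 * (M *ᵥ y) a + M a a * t) := by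
    rw [hu, mulVec_add, add_dotProduct, dotProduct_add, dotProduct_add, hy,
      dotProduct_mulVec_comm_of_isSymm hM y, single_dotProduct, single_dotProduct, mulVec_single]
    simp
    ring
  have hu2 : u ⬝ᵥ M *ᵥ u = -(2 * (u ⬝ᵥ M *ᵥ g) + g ⬝ᵥ M *ᵥ g) := by
    have : y' = u + g := by simp [hg]
    rw [this, mulVec_add, add_dotProduct, dotProduct_add, dotProduct_add,
      dotProduct_mulVec_comm_of_isSymm hM g u] at hy'
    linear_combination hy'
  have hmem : u ⬝ᵥ M *ᵥ u ∈ q ^ r := by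
    have hmv : ∀ z : Fin 3 → R, z ⬝ᵥ M *ᵥ g ∈ q ^ r := fun z =>
      Ideal.sum_mem _ fun b _ => Ideal.mul_mem_left _ _ (mulVec_mem hgm b)
    rw [hu2]
    exact (q ^ r).neg_mem ((q ^ r).add_mem (Ideal.mul_mem_left _ _ (hmv _)) (hmv _))
  rw [hu1] at hmem
  refine (Ideal.IsPrime.mem_pow_mul q hmem).resolve_right fun hbad => ?_
  have := (q.add_mem_iff_left (q.mul_mem_left (M a a) hq1)).1 hbad
  exact (hq.mem_or_mem this).elim h2 hl

theorem mem_pow_of_sq_mem_pow (v : HeightOneSpectrum R) {d : R} {m : ℕ}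
    (h : d ^ 2 ∈ v.asIdeal ^ (2 * m)) : d ∈ v.asIdeal ^ m := by
  rw [← v.intValuation_le_pow_iff_mem] at h ⊢
  rw [map_pow] at h
  refine (pow_le_pow_iff_left₀ zero_le zero_le two_ne_zero).1 (h.trans_eq ?_)
  rw [← WithZero.exp_nsmul]
  congr 1
  push_cast
  simp

/-- Three points of the conic which are projectively congruent modulo `q ^ r` have determinant
in `q ^ (3 * r)`. -/
theorem det_mem_pow_of_isotropic (v : HeightOneSpectrum R) (h2 : (2 : R) ∉ v.asIdeal)
    (hM : M.IsSymm) (hdet : M.det ∉ v.asIdeal) (x : Matrix (Fin 3) (Fin 3) R)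
    (hx : ∀ i, x i ⬝ᵥ M *ᵥ x i = 0) (s : Fin 3 → R) (hs : ∀ i, s i ∉ v.asIdeal) {r : ℕ}
    (hr : ∀ i j a, s i * x i a - s j * x j a ∈ v.asIdeal ^ r) :
    x.det ∈ v.asIdeal ^ (3 * r) := by
  have hB : ∀ i j, x i ⬝ᵥ M *ᵥ x j ∈ v.asIdeal ^ (r + r) := fun i j => by
    set g : Fin 3 → R := s i • x i - s j • x j with hg
    have hgm : g ⬝ᵥ M *ᵥ g ∈ v.asIdeal ^ (r + r) := by
      rw [pow_add]
      exact dotProduct_mem_mul (fun a => hr i j a) (mulVec_mem fun a => hr i j a)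
    have hge : g ⬝ᵥ M *ᵥ g = (-(2 * s i * s j)) * (x i ⬝ᵥ M *ᵥ x j) := by
      rw [hg, mulVec_sub, sub_dotProduct, dotProduct_sub, dotProduct_sub]
      simp only [mulVec_smul, smul_dotProduct, dotProduct_smul, hx, smul_eq_mul,
        dotProduct_mulVec_comm_of_isSymm hM (x j) (x i)]
      ring
    rw [hge] at hgm
    refine (Ideal.IsPrime.mul_mem_pow v.asIdeal hgm).resolve_left fun hbad => ?_
    rw [neg_mem_iff] at hbad
    rcases v.isPrime.mem_or_mem hbad with hb | hb
    · exact (v.isPrime.mem_or_mem hb).elim h2 (hs i)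
    · exact hs j hb
  have hprod := two_mul_gram_eq hM x hx
  have hmem : x.det ^ 2 * M.det ∈ v.asIdeal ^ (2 * (3 * r)) := by
    rw [← hprod, show 2 * (3 * r) = (r + r) + (r + r) + (r + r) by ring, pow_add, pow_add]
    exact Ideal.mul_mem_mul (Ideal.mul_mem_mul (Ideal.mul_mem_left _ _ (hB 0 1)) (hB 0 2)) (hB 1 2)
  exact mem_pow_of_sq_mem_pow v ((Ideal.IsPrime.mem_pow_mul v.asIdeal hmem).resolve_right hdet)

end Conic

open Matrix in
/-- If points of a conic with good reduction at `v` have vanishing determinant as soon as it lies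
in `v ^ (3 * r)`, then their number is bounded by the number of classes modulo `v ^ r`. -/
theorem natCard_le_of_isotropic (v : HeightOneSpectrum (𝓞 k)) (h2 : (2 : 𝓞 k) ∉ v.asIdeal)
    {M : Matrix (Fin 3) (Fin 3) (𝓞 k)} (hM : M.IsSymm) (hdet : M.det ∉ v.asIdeal)
    {T : Type*} (x : T → Fin 3 → 𝓞 k) (hx : ∀ t, x t ⬝ᵥ M *ᵥ x t = 0)
    (hprim : ∀ t, ∃ j, x t j ∉ v.asIdeal) (r : ℕ)
    (hcol : ∀ t : Fin 3 → T, (Matrix.of fun i => x (t i)).det ∈ v.asIdeal ^ (3 * r) →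
      (Matrix.of fun i => x (t i)).det = 0)
    (hinj : ∀ t t', (∀ a b, x t a * x t' b = x t b * x t' a) → t = t') :
    Nat.card T ≤ 54 * Ideal.absNorm v.asIdeal ^ 3 * Ideal.absNorm v.asIdeal ^ r := by
  have := v.isPrime
  choose j hj using hprim
  have hs : ∀ t, ∃ s, s * x t (j t) - 1 ∈ v.asIdeal ^ (r + 1) := fun t => by
    have hcop : IsCoprime (Ideal.span {x t (j t)}) (v.asIdeal ^ (r + 1)) := by
      refine IsCoprime.pow_right ?_
      obtain ⟨b, c, hc, hbc⟩ := v.isMaximal.exists_inv (hj t)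
      exact Ideal.isCoprime_iff_exists.2
        ⟨_, Ideal.mul_mem_left _ b (Ideal.mem_span_singleton_self _), c, hc, hbc⟩
    obtain ⟨a, ha, b, hb, hab⟩ := Ideal.isCoprime_iff_exists.1 hcop
    obtain ⟨s, rfl⟩ := Ideal.mem_span_singleton'.1 ha
    refine ⟨s, ?_⟩
    rw [← hab, sub_add_cancel_left]
    exact (v.asIdeal ^ (r + 1)).neg_mem hb
  choose s hs using hs
  have hsr : ∀ t, s t * x t (j t) - 1 ∈ v.asIdeal ^ r := fun t =>
    Ideal.pow_le_pow_right (Nat.le_succ r) (hs t)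
  have hsq : ∀ t, s t ∉ v.asIdeal := fun t hst => by
    have h1 := Ideal.pow_le_self (Nat.succ_ne_zero r) (hs t)
    refine v.isPrime.ne_top ((Ideal.eq_top_iff_one _).2 ?_)
    rw [show (1 : 𝓞 k) = s t * x t (j t) - (s t * x t (j t) - 1) by ring]
    exact v.asIdeal.sub_mem (v.asIdeal.mul_mem_right _ hst) h1
  have hy : ∀ t, (s t • x t) ⬝ᵥ M *ᵥ (s t • x t) = 0 := fun t => by
    simp [mulVec_smul, hx]
  have hyj : ∀ t, (s t • x t) (j t) ∉ v.asIdeal := fun t hbad =>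
    (v.isPrime.mem_or_mem hbad).elim (hsq t) (hj t)
  choose l hlj hl using fun t => exists_mulVec_notMem (q := v.asIdeal) hdet (hy t) (hyj t)
  choose i hi using fun t => (by decide : ∀ j l : Fin 3, l ≠ j → ∃ i, ∀ m, m ≠ l → m = j ∨ m = i)
    (j t) (l t) (hlj t)
  have hfin : ∀ n : ℕ, Finite (𝓞 k ⧸ v.asIdeal ^ n) := fun n =>
    Ideal.finiteQuotientOfFreeOfNeBot _ (pow_ne_zero _ v.ne_bot)
  have hfin1 : Finite (𝓞 k ⧸ v.asIdeal) := Ideal.finiteQuotientOfFreeOfNeBot _ v.ne_bot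
  have := Fintype.ofFinite (𝓞 k ⧸ v.asIdeal)
  have := Fintype.ofFinite (𝓞 k ⧸ v.asIdeal ^ r)
  let Φ : T → Fin 3 × Fin 3 × Fin 3 × (Fin 3 → 𝓞 k ⧸ v.asIdeal) × (𝓞 k ⧸ v.asIdeal ^ r) :=
    fun t => (j t, l t, i t, fun a => Ideal.Quotient.mk _ ((s t • x t) a),
      Ideal.Quotient.mk _ ((s t • x t) (i t)))
  refine (natCard_le_two_mul Φ fun t ht => ?_).trans_eq ?_
  · have hcong : ∀ m n a, s (t m) * x (t m) a - s (t n) * x (t n) a ∈ v.asIdeal ^ r := by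
      intro m n
      have h := ht m n
      simp only [Φ, Prod.mk.injEq, _root_.funext_iff, Ideal.Quotient.eq] at h
      obtain ⟨h1, h2', h3, h4, h5⟩ := h
      refine sub_mem_pow_of_isotropic h2 hM (hy (t n)) (hy (t m)) (hl _) (h4 _) fun a ha => ?_
      rcases hi _ a ha with rfl | rfl
      · have := (v.asIdeal ^ r).sub_mem (hsr (t m)) (hsr (t n))
        rw [h1] at this
        simpa using this
      · rw [← h3] at h5 ⊢
        exact h5
    obtain ⟨m, n, hmn, hp⟩ := exists_proportional_of_det_eq_zero
      (fun h => h2 (h ▸ v.asIdeal.zero_mem)) hM (fun h => hdet (h ▸ v.asIdeal.zero_mem))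
      (Matrix.of fun i => x (t i)) (fun i => hx (t i))
      (hcol t (det_mem_pow_of_isotropic v h2 hM hdet _ (fun i => hx (t i)) (fun i => s (t i))
        (fun i => hsq _) hcong))
    exact ⟨m, n, hmn, hinj _ _ hp⟩
  · have hc : ∀ I : Ideal (𝓞 k), ∀ _ : Fintype (𝓞 k ⧸ I), Fintype.card (𝓞 k ⧸ I) = Ideal.absNorm I :=
      fun I _ => by rw [Ideal.absNorm_apply, Submodule.cardQuot_apply, Nat.card_eq_fintype_card]
    simp only [Fintype.card_prod, Fintype.card_fun, Fintype.card_fin, hc, map_pow]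
    ring
section Places

theorem fnorm_eq_mk (v : HeightOneSpectrum (𝓞 k)) (z : k) : fnorm v z = FinitePlace.mk v z := by
  rw [FinitePlace.mk_apply, FinitePlace.norm_embedding, HeightOneSpectrum.adicAbv_def, fnorm]
  split_ifs with h
  · rw [WithZeroMulInt.toNNReal_pos_apply _ h, NNReal.coe_zero]
  · rw [WithZeroMulInt.toNNReal_neg_apply _ h]
    simp

theorem fnorm_mul (v : HeightOneSpectrum (𝓞 k)) (x y : k) :
    fnorm v (x * y) = fnorm v x * fnorm v y := by simp [fnorm_eq_mk]

theorem fnorm_nonneg (v : HeightOneSpectrum (𝓞 k)) (x : k) : 0 ≤ fnorm v x := by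
  simp [fnorm_eq_mk]

theorem fnorm_pos (v : HeightOneSpectrum (𝓞 k)) {x : k} (hx : x ≠ 0) : 0 < fnorm v x := by
  rw [fnorm_eq_mk]
  exact FinitePlace.pos_iff.2 hx

theorem fnorm_le_one (v : HeightOneSpectrum (𝓞 k)) (x : 𝓞 k) :
    fnorm v (algebraMap (𝓞 k) k x) ≤ 1 := by
  rw [fnorm_eq_mk]
  exact FinitePlace.norm_le_one k v x

theorem fnorm_eq_one (v : HeightOneSpectrum (𝓞 k)) {x : 𝓞 k} (hx : x ∉ v.asIdeal) :
    fnorm v (algebraMap (𝓞 k) k x) = 1 := by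
  rw [fnorm_eq_mk]
  exact (FinitePlace.norm_eq_one_iff_notMem k v x).2 hx

theorem fnorm_le_of_mem_pow (v : HeightOneSpectrum (𝓞 k)) {x : 𝓞 k} {m : ℕ}
    (hx : x ∈ v.asIdeal ^ m) :
    fnorm v (algebraMap (𝓞 k) k x) ≤ ((Ideal.absNorm v.asIdeal : ℝ) ^ m)⁻¹ := by
  rw [fnorm_eq_mk, FinitePlace.mk_apply, FinitePlace.norm_embedding, HeightOneSpectrum.adicAbv_def]
  have h := (v.intValuation_le_pow_iff_mem x m).2 hx
  rw [← v.valuation_of_algebraMap (K := k)] at h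
  have h2 := (WithZeroMulInt.toNNReal_strictMono
    (HeightOneSpectrum.one_lt_absNorm_nnreal v)).monotone h
  refine (NNReal.coe_le_coe.2 h2).trans_eq ?_
  rw [WithZeroMulInt.toNNReal_neg_apply _ WithZero.exp_ne_zero]
  have hu : ∀ h : WithZero.exp (-(m : ℤ)) ≠ 0,
      WithZero.unzero h = Multiplicative.ofAdd (-(m : ℤ)) := fun h => WithZero.unzero_coe h
  rw [hu]
  simp

theorem hasFiniteMulSupport_fnorm {x : k} (hx : x ≠ 0) :
    (fun v : HeightOneSpectrum (𝓞 k) => fnorm v x).HasFiniteMulSupport := by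
  simp_rw [fnorm_eq_mk]
  exact (FinitePlace.hasFiniteMulSupport hx).comp_of_injective
    FinitePlace.equivHeightOneSpectrum.symm.injective

theorem prod_mul_finprod_fnorm {x : k} (hx : x ≠ 0) :
    (∏ w : InfinitePlace k, w x ^ w.mult) * ∏ᶠ v : HeightOneSpectrum (𝓞 k), fnorm v x = 1 := by
  rw [← NumberField.prod_abs_eq_one hx, ← finprod_comp_equiv FinitePlace.equivHeightOneSpectrum]
  simp_rw [fnorm_eq_mk, FinitePlace.equivHeightOneSpectrum_apply, FinitePlace.mk_maximalIdeal]

theorem fnorm_sum_le (v : HeightOneSpectrum (𝓞 k)) {ι : Type*} (s : Finset ι) (g : ι → k) {c : ℝ}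
    (hc : 0 ≤ c) (hg : ∀ i ∈ s, fnorm v (g i) ≤ c) : fnorm v (∑ i ∈ s, g i) ≤ c := by
  simp_rw [fnorm_eq_mk, FinitePlace.mk_apply, FinitePlace.norm_embedding] at hg ⊢
  induction s using Finset.cons_induction with
  | empty => simpa
  | cons i s hi ih =>
    rw [Finset.sum_cons]
    exact le_trans (NumberField.HeightOneSpectrum.isNonarchimedean_adicAbv k v _ _)
      (max_le (hg _ (Finset.mem_cons_self _ _)) (ih fun j hj => hg _ (Finset.mem_cons_of_mem hj)))

end Places

section MaxAt

variable {ι : Type} [Fintype ι] [Nonempty ι]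

theorem le_maxAt (w : InfinitePlace k) (z : ι → k) (i : ι) : w (z i) ≤ maxAt w z :=
  Finset.le_sup' (fun i => w (z i)) (Finset.mem_univ i)

theorem maxAt_nonneg (w : InfinitePlace k) (z : ι → k) : 0 ≤ maxAt w z :=
  (apply_nonneg w _).trans (le_maxAt w z (Classical.arbitrary ι))

theorem maxAt_pos (w : InfinitePlace k) {z : ι → k} (hz : z ≠ 0) : 0 < maxAt w z := by
  obtain ⟨i, hi⟩ := Function.ne_iff.1 hz
  exact (InfinitePlace.pos_iff.2 hi).trans_le (le_maxAt w z i)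

theorem le_maxAtFin (v : HeightOneSpectrum (𝓞 k)) (z : ι → k) (i : ι) :
    fnorm v (z i) ≤ maxAtFin v z :=
  Finset.le_sup' (fun i => fnorm v (z i)) (Finset.mem_univ i)

theorem maxAtFin_nonneg (v : HeightOneSpectrum (𝓞 k)) (z : ι → k) : 0 ≤ maxAtFin v z :=
  (fnorm_nonneg v _).trans (le_maxAtFin v z (Classical.arbitrary ι))

theorem maxAtFin_le_one (v : HeightOneSpectrum (𝓞 k)) (z : ι → 𝓞 k) :
    maxAtFin v (fun i => algebraMap (𝓞 k) k (z i)) ≤ 1 :=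
  Finset.sup'_le _ _ fun i _ => fnorm_le_one v (z i)

theorem maxAtFin_eq_one (v : HeightOneSpectrum (𝓞 k)) {z : ι → 𝓞 k} (hz : ∃ i, z i ∉ v.asIdeal) :
    maxAtFin v (fun i => algebraMap (𝓞 k) k (z i)) = 1 := by
  obtain ⟨i, hi⟩ := hz
  refine le_antisymm (maxAtFin_le_one v z) ?_
  rw [← fnorm_eq_one v hi]
  exact le_maxAtFin v (fun i => algebraMap (𝓞 k) k (z i)) i

theorem hasFiniteMulSupport_maxAtFin {z : ι → k} (hz : z ≠ 0) :
    (fun v : HeightOneSpectrum (𝓞 k) => maxAtFin v z).HasFiniteMulSupport := by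
  refine (Set.finite_iUnion fun i : {i // z i ≠ 0} =>
    hasFiniteMulSupport_fnorm i.2).subset fun v hv => ?_
  by_contra hcon
  simp only [Set.mem_iUnion, Function.mem_mulSupport, not_exists, not_not] at hcon
  obtain ⟨i, hi⟩ := Function.ne_iff.1 hz
  refine hv (le_antisymm (Finset.sup'_le _ _ fun j _ => ?_) ?_)
  · by_cases hj : z j = 0
    · simp [hj, fnorm]
    · exact (hcon ⟨j, hj⟩).le
  · exact (hcon ⟨i, hi⟩).symm.le.trans (le_maxAtFin v z i)

/-- The contribution of the infinite places to the height. -/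
def infHeight (z : ι → k) : ℝ := ∏ w : InfinitePlace k, maxAt w z ^ w.mult

theorem infHeight_pos {z : ι → k} (hz : z ≠ 0) : 0 < infHeight z :=
  Finset.prod_pos fun w _ => pow_pos (maxAt_pos w hz) _

theorem infHeight_rpow (z : ι → k) (s : ℝ) :
    infHeight z ^ s = ∏ w : InfinitePlace k, (maxAt w z ^ s) ^ w.mult := by
  rw [infHeight, ← Real.finsetProd_rpow _ _ fun w _ => pow_nonneg (maxAt_nonneg w z) _]
  refine Finset.prod_congr rfl fun w _ => ?_
  rw [← Real.rpow_natCast, ← Real.rpow_natCast, ← Real.rpow_mul (maxAt_nonneg w z),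
    ← Real.rpow_mul (maxAt_nonneg w z), mul_comm]

/-- The factor at `w` of the height of `x` twisted by `z`. -/
def twistAt (a : Fin 3 → ℤ) (w : InfinitePlace k) (z : ι → k) (x : Fin 3 → k) : ℝ :=
  Finset.univ.sup' Finset.univ_nonempty fun j => maxAt w z ^ ((a j : ℤ) : ℝ) * w (x j)

theorem le_twistAt (a : Fin 3 → ℤ) (w : InfinitePlace k) (z : ι → k) (x : Fin 3 → k) (j : Fin 3) :
    maxAt w z ^ ((a j : ℤ) : ℝ) * w (x j) ≤ twistAt a w z x :=
  Finset.le_sup' (fun j => maxAt w z ^ ((a j : ℤ) : ℝ) * w (x j)) (Finset.mem_univ j)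

theorem twistAt_nonneg (a : Fin 3 → ℤ) (w : InfinitePlace k) (z : ι → k) (x : Fin 3 → k) :
    0 ≤ twistAt a w z x :=
  (mul_nonneg (Real.rpow_nonneg (maxAt_nonneg w z) _) (apply_nonneg w _)).trans
    (le_twistAt a w z x 0)

/-- The height of `x`, with `x j` scaled by the `a j`-th power of the size of `z` at the infinite
places. -/
def twistHeight (a : Fin 3 → ℤ) (z : ι → k) (x : Fin 3 → k) : ℝ :=
  (∏ w : InfinitePlace k, twistAt a w z x ^ w.mult) *
    ∏ᶠ v : HeightOneSpectrum (𝓞 k), maxAtFin v x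

theorem twistHeight_nonneg (a : Fin 3 → ℤ) (z : ι → k) (x : Fin 3 → k) :
    0 ≤ twistHeight a z x :=
  mul_nonneg (Finset.prod_nonneg fun w _ => pow_nonneg (twistAt_nonneg a w z x) _)
    (finprod_nonneg fun v => maxAtFin_nonneg v x)

/-- A lower bound coming from the product formula. -/
theorem prod_le_of_fnorm_le {D : k} (hD : D ≠ 0) {c p : InfinitePlace k → ℝ} (hc : ∀ w, 0 ≤ c w)
    (hp : ∀ w, c w * w D ≤ p w) {G : HeightOneSpectrum (𝓞 k) → ℝ} (hG : G.HasFiniteMulSupport)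
    (hDG : ∀ v, fnorm v D ≤ G v) :
    ∏ w, c w ^ w.mult ≤ (∏ w, p w ^ w.mult) * ∏ᶠ v, G v := by
  calc ∏ w, c w ^ w.mult = (∏ w, c w ^ w.mult) * ((∏ w : InfinitePlace k, w D ^ w.mult) *
        ∏ᶠ v : HeightOneSpectrum (𝓞 k), fnorm v D) := by rw [prod_mul_finprod_fnorm hD, mul_one]
    _ = (∏ w, (c w * w D) ^ w.mult) * ∏ᶠ v : HeightOneSpectrum (𝓞 k), fnorm v D := by
      simp_rw [mul_pow, Finset.prod_mul_distrib, mul_assoc]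
    _ ≤ (∏ w, p w ^ w.mult) * ∏ᶠ v, G v := by
      have h0 : ∀ w : InfinitePlace k, 0 ≤ c w * w D := fun w => mul_nonneg (hc w) (apply_nonneg w D)
      refine mul_le_mul (Finset.prod_le_prod (fun w _ => pow_nonneg (h0 w) _) fun w _ =>
        pow_le_pow_left₀ (h0 w) (hp w) _) (finprod_le_finprod (hasFiniteMulSupport_fnorm hD)
          (fun v => fnorm_nonneg v D) hG hDG) (finprod_nonneg fun v => fnorm_nonneg v D)
        (Finset.prod_nonneg fun w _ => pow_nonneg ((h0 w).trans (hp w)) _)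

theorem infHeight_rpow_le_twistHeight (a : Fin 3 → ℤ) (z : ι → k) {x : Fin 3 → k} {j : Fin 3}
    (hj : x j ≠ 0) : infHeight z ^ ((a j : ℤ) : ℝ) ≤ twistHeight a z x := by
  rw [infHeight_rpow]
  exact prod_le_of_fnorm_le hj (fun w => Real.rpow_nonneg (maxAt_nonneg w z) _)
    (fun w => le_twistAt a w z x j) (hasFiniteMulSupport_maxAtFin (Function.ne_iff.2 ⟨j, hj⟩))
    fun v => le_maxAtFin v x j

theorem apply_det_le (w : InfinitePlace k) (M : Matrix (Fin 3) (Fin 3) k) :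
    w M.det ≤ ∑ σ : Equiv.Perm (Fin 3), ∏ i, w (M (σ i) i) := by
  rw [Matrix.det_apply]
  refine (w.1.sum_le _ _).trans_eq (Finset.sum_congr rfl fun σ _ => ?_)
  change w _ = _
  rw [Units.smul_def, zsmul_eq_mul, map_mul, map_prod]
  have hw : w (-1) = 1 := (map_neg_eq_map w.1 1).trans (map_one w)
  rcases Int.units_eq_one_or (Equiv.Perm.sign σ) with h | h <;> simp [h, hw]

theorem apply_det_mul_le (a : Fin 3 → ℤ) (w : InfinitePlace k) {z : ι → k} (hz : z ≠ 0)
    (x : Fin 3 → Fin 3 → k) :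
    maxAt w z ^ (((a 0 : ℤ) : ℝ) + ((a 1 : ℤ) : ℝ) + ((a 2 : ℤ) : ℝ)) * w (Matrix.of x).det ≤
      6 * ∏ i, twistAt a w z (x i) := by
  have hZ := maxAt_pos w hz
  calc maxAt w z ^ (((a 0 : ℤ) : ℝ) + ((a 1 : ℤ) : ℝ) + ((a 2 : ℤ) : ℝ)) * w (Matrix.of x).det
      ≤ maxAt w z ^ (((a 0 : ℤ) : ℝ) + ((a 1 : ℤ) : ℝ) + ((a 2 : ℤ) : ℝ)) *
        ∑ σ : Equiv.Perm (Fin 3), ∏ i, w (x (σ i) i) :=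
        mul_le_mul_of_nonneg_left (apply_det_le w _) (Real.rpow_nonneg hZ.le _)
    _ = ∑ σ : Equiv.Perm (Fin 3), ∏ i, (maxAt w z ^ ((a i : ℤ) : ℝ) * w (x (σ i) i)) := by
        rw [Finset.mul_sum]
        refine Finset.sum_congr rfl fun σ _ => ?_
        rw [Finset.prod_mul_distrib, ← Real.rpow_sum_of_pos hZ, Fin.sum_univ_three]
    _ ≤ ∑ σ : Equiv.Perm (Fin 3), ∏ i, twistAt a w z (x i) := by
        refine Finset.sum_le_sum fun σ _ => ?_
        rw [← Equiv.prod_comp σ fun i => twistAt a w z (x i)]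
        exact Finset.prod_le_prod (fun i _ => mul_nonneg (Real.rpow_nonneg hZ.le _)
          (apply_nonneg w _)) fun i _ => le_twistAt a w z (x (σ i)) i
    _ = 6 * ∏ i, twistAt a w z (x i) := by
        rw [Finset.sum_const, Finset.card_univ, Fintype.card_perm, nsmul_eq_mul]
        norm_num [Nat.factorial]

theorem fnorm_det_le (v : HeightOneSpectrum (𝓞 k)) (x : Fin 3 → Fin 3 → k) :
    fnorm v (Matrix.of x).det ≤ ∏ i, maxAtFin v (x i) := by
  rw [Matrix.det_apply]
  refine fnorm_sum_le v _ _ (Finset.prod_nonneg fun i _ => maxAtFin_nonneg v _) fun σ _ => ?_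
  rw [Units.smul_def, zsmul_eq_mul, fnorm_mul, ← Equiv.prod_comp σ fun i => maxAtFin v (x i)]
  have h1 : fnorm v (((Equiv.Perm.sign σ : ℤˣ) : ℤ) : k) = 1 := by
    rcases Int.units_eq_one_or (Equiv.Perm.sign σ) with h | h <;> simp [h, fnorm_eq_mk]
  rw [h1, one_mul, fnorm_eq_mk, map_prod]
  refine Finset.prod_le_prod (fun i _ => apply_nonneg _ _) fun i _ => ?_
  rw [← fnorm_eq_mk]
  exact le_maxAtFin v (x (σ i)) i

/-- Three points whose determinant is divisible by a high power of `v` have large height. -/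
theorem pow_mul_le_prod_twistHeight (a : Fin 3 → ℤ) {z : ι → k} (hz : z ≠ 0)
    (v : HeightOneSpectrum (𝓞 k)) (x : Fin 3 → Fin 3 → 𝓞 k) (hx : ∀ i, ∃ j, x i j ∉ v.asIdeal)
    {m : ℕ} (hdet : (Matrix.of x).det ∈ v.asIdeal ^ m) (hdet0 : (Matrix.of x).det ≠ 0) :
    (Ideal.absNorm v.asIdeal : ℝ) ^ m *
        infHeight z ^ (((a 0 : ℤ) : ℝ) + ((a 1 : ℤ) : ℝ) + ((a 2 : ℤ) : ℝ)) ≤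
      (∏ w : InfinitePlace k, (6 : ℝ) ^ w.mult) *
        ∏ i, twistHeight a z fun j => algebraMap (𝓞 k) k (x i j) := by
  classical
  set N : ℝ := (Ideal.absNorm v.asIdeal : ℝ)
  have hN : 0 < N := by
    have := HeightOneSpectrum.one_lt_absNorm_nnreal v
    exact Nat.cast_pos.2 (Nat.pos_of_ne_zero fun h => by simp [h] at this)
  set y : Fin 3 → Fin 3 → k := fun i j => algebraMap (𝓞 k) k (x i j)
  have hy : (Matrix.of y).det = algebraMap (𝓞 k) k (Matrix.of x).det := by
    rw [RingHom.map_det]; rfl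
  have hy0 : ∀ i, y i ≠ 0 := fun i h => by
    obtain ⟨j, hj⟩ := hx i
    have : x i j = 0 := by simpa [y] using congr_fun h j
    exact hj (this ▸ v.asIdeal.zero_mem)
  have hD : (Matrix.of y).det ≠ 0 := by
    rw [hy]
    simpa using hdet0
  let g : HeightOneSpectrum (𝓞 k) → ℝ := fun u => if u = v then (N ^ m)⁻¹ else 1
  have hg : g.HasFiniteMulSupport := (Set.finite_singleton v).subset fun u hu => by
    by_contra h
    exact hu (if_neg h)
  have hgv : ∏ᶠ u, g u = (N ^ m)⁻¹ := by
    rw [finprod_eq_single g v fun u hu => if_neg hu]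
    exact if_pos rfl
  have hfin : (fun u : HeightOneSpectrum (𝓞 k) =>
      ∏ i, maxAtFin u (y i)).HasFiniteMulSupport :=
    Function.HasFiniteMulSupport.prod (fun i => hasFiniteMulSupport_maxAtFin (hy0 i)) _
  have key := prod_le_of_fnorm_le hD (c := fun w => maxAt w z ^
      (((a 0 : ℤ) : ℝ) + ((a 1 : ℤ) : ℝ) + ((a 2 : ℤ) : ℝ)))
    (p := fun w => 6 * ∏ i, twistAt a w z (y i))
    (fun w => Real.rpow_nonneg (maxAt_nonneg w z) _) (fun w => apply_det_mul_le a w hz y)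
    (G := fun u => g u * ∏ i, maxAtFin u (y i)) (hg.mul hfin) fun u => by
      by_cases hu : u = v
      · subst hu
        have h1 : ∀ i, maxAtFin u (y i) = 1 := fun i => maxAtFin_eq_one u (hx i)
        simp only [g, h1, if_true, Finset.prod_const_one, mul_one]
        rw [hy]
        exact fnorm_le_of_mem_pow u hdet
      · simp only [g, if_neg hu, one_mul]
        exact fnorm_det_le u y
  rw [← infHeight_rpow, finprod_mul_distrib hg hfin, hgv,
    finprod_prod_comm _ _ fun i _ => hasFiniteMulSupport_maxAtFin (hy0 i)] at key
  simp_rw [mul_pow, Finset.prod_mul_distrib, ← Finset.prod_pow] at key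
  rw [Finset.prod_comm] at key
  refine (mul_le_mul_of_nonneg_left key (pow_pos hN m).le).trans_eq ?_
  simp_rw [twistHeight, Finset.prod_mul_distrib]
  field_simp
  rfl

/-- The product over the finite places of the absolute values of `x`. -/
def finAbs (x : k) : ℝ := ∏ᶠ v : HeightOneSpectrum (𝓞 k), fnorm v x

theorem finAbs_pos {x : k} (hx : x ≠ 0) : 0 < finAbs x := by
  have h := prod_mul_finprod_fnorm hx
  refine (finprod_nonneg fun v => fnorm_nonneg v x).lt_of_ne fun h0 => ?_
  rw [← h0, mul_zero] at h
  exact zero_ne_one h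

theorem fnorm_le_maxAtFin_of_mem_span {z : ι → 𝓞 k} {b : 𝓞 k} (hb : b ∈ Ideal.span (Set.range z))
    (v : HeightOneSpectrum (𝓞 k)) :
    fnorm v (algebraMap (𝓞 k) k b) ≤ maxAtFin v fun i => algebraMap (𝓞 k) k (z i) := by
  obtain ⟨c, rfl⟩ := (Ideal.mem_span_range_iff_exists_fun).1 hb
  rw [map_sum]
  refine fnorm_sum_le v _ _ (maxAtFin_nonneg v _) fun i _ => ?_
  rw [map_mul, fnorm_mul]
  exact (mul_le_of_le_one_left (fnorm_nonneg v _) (fnorm_le_one v (c i))).trans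
    (le_maxAtFin v (fun i => algebraMap (𝓞 k) k (z i)) i)

theorem Hproj_le_infHeight {z : ι → 𝓞 k} (hz : (fun i => algebraMap (𝓞 k) k (z i)) ≠ 0) :
    Hproj (fun i => algebraMap (𝓞 k) k (z i)) ≤ infHeight fun i => algebraMap (𝓞 k) k (z i) := by
  refine mul_le_of_le_one_right (infHeight_pos hz).le ?_
  rw [← finprod_one (α := HeightOneSpectrum (𝓞 k))]
  exact finprod_le_finprod (hasFiniteMulSupport_maxAtFin hz) (fun v => maxAtFin_nonneg v _)
    Function.hasFiniteMulSupport_one fun v => maxAtFin_le_one v z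

theorem finAbs_mul_infHeight_le_Hproj {z : ι → 𝓞 k}
    (hz : (fun i => algebraMap (𝓞 k) k (z i)) ≠ 0) {b : 𝓞 k} (hb0 : b ≠ 0)
    (hb : b ∈ Ideal.span (Set.range z)) :
    finAbs (algebraMap (𝓞 k) k b) * infHeight (fun i => algebraMap (𝓞 k) k (z i)) ≤
      Hproj fun i => algebraMap (𝓞 k) k (z i) := by
  rw [mul_comm]
  refine mul_le_mul_of_nonneg_left ?_ (infHeight_pos hz).le
  exact finprod_le_finprod (hasFiniteMulSupport_fnorm (by simpa using hb0))
    (fun v => fnorm_nonneg v _) (hasFiniteMulSupport_maxAtFin hz)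
    fun v => fnorm_le_maxAtFin_of_mem_span hb v

theorem pow_le_rpow_of_le {β m s : ℝ} {K : ℕ} (hβ : 0 < β) (hβm : β ≤ m) (hm : m ≤ 1)
    (hs : s ≤ K) : β ^ K ≤ m ^ s :=
  (pow_le_pow_left₀ hβ.le hβm K).trans
    (by simpa using Real.rpow_le_rpow_of_exponent_ge (hβ.trans_le hβm) hm hs)

end MaxAt

/-- A lower bound for the standard height of a point over an integral point `z`. -/
theorem mul_twistHeight_le_Hstd (a : Fin 3 → ℤ) (e : ℤ) (α : ℚ)
    (f : Fin 3 → Fin 3 → MvPolynomial (Fin (n + 1)) (𝓞 k)) {K : ℕ} (hA : Aexp n a e α ≤ K)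
    (ha : ∀ j, ((a j : ℤ) : ℝ) ≤ K) {z : Fin (n + 1) → 𝓞 k} {b : 𝓞 k} (hb0 : b ≠ 0)
    (hb : b ∈ Ideal.span (Set.range z)) (P : PtRep k n f)
    (hP : P.y = fun i => algebraMap (𝓞 k) k (z i)) :
    finAbs (algebraMap (𝓞 k) k b) ^ (2 * K) * (infHeight P.y ^ Aexp n a e α *
      twistHeight a P.y P.x) ≤ Hstd a e α f P := by
  have hb0' : algebraMap (𝓞 k) k b ≠ 0 := by simpa using hb0
  have hβ := fun v => fnorm_pos v hb0'
  have hβm : ∀ v, fnorm v (algebraMap (𝓞 k) k b) ≤ maxAtFin v P.y := fun v => by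
    rw [hP]; exact fnorm_le_maxAtFin_of_mem_span hb v
  have hm : ∀ v, maxAtFin v P.y ≤ 1 := fun v => by
    rw [hP]; exact maxAtFin_le_one v z
  have hsβ := hasFiniteMulSupport_fnorm hb0'
  have hsx := hasFiniteMulSupport_maxAtFin P.hx
  have hinf : ∏ w : InfinitePlace k, (maxAt w P.y ^ Aexp n a e α *
      Finset.univ.sup' Finset.univ_nonempty
        (fun j => maxAt w P.y ^ ((a j : ℤ) : ℝ) * w (P.x j))) ^ w.mult =
      infHeight P.y ^ Aexp n a e α * ∏ w : InfinitePlace k, twistAt a w P.y P.x ^ w.mult := by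
    simp_rw [mul_pow, Finset.prod_mul_distrib, ← infHeight_rpow]
    rfl
  have hfin : finAbs (algebraMap (𝓞 k) k b) ^ (2 * K) *
      ∏ᶠ v : HeightOneSpectrum (𝓞 k), maxAtFin v P.x ≤ ∏ᶠ v : HeightOneSpectrum (𝓞 k),
        (maxAtFin v P.y ^ Aexp n a e α * Finset.univ.sup' Finset.univ_nonempty
          (fun j => maxAtFin v P.y ^ ((a j : ℤ) : ℝ) * fnorm v (P.x j))) := by
    have hsβK : (fun v : HeightOneSpectrum (𝓞 k) =>
      fnorm v (algebraMap (𝓞 k) k b) ^ (2 * K)).HasFiniteMulSupport := hsβ.pow _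
    rw [finAbs, finprod_pow hsβ, ← finprod_mul_distrib hsβK hsx]
    refine finprod_le_finprod (hsβK.mul hsx) (fun v => mul_nonneg
      (pow_nonneg (fnorm_nonneg v _) _) (maxAtFin_nonneg v _)) ?_ fun v => ?_
    · refine (hsβ.union hsx).subset fun v hv => ?_
      by_contra hcon
      simp only [Set.mem_union, Function.mem_mulSupport, not_or, not_not] at hcon
      have h1 : maxAtFin v P.y = 1 := le_antisymm (hm v) (hcon.1 ▸ hβm v)
      refine hv ?_
      simp only [h1, Real.one_rpow, one_mul]
      exact hcon.2
    · obtain ⟨j, -, hj⟩ := Finset.exists_mem_eq_sup' Finset.univ_nonempty fun j => fnorm v (P.x j)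
      have h1 := pow_le_rpow_of_le (hβ v) (hβm v) (hm v) hA
      have h2 := pow_le_rpow_of_le (hβ v) (hβm v) (hm v) (ha j)
      have h0 := pow_nonneg (hβ v).le K
      change _ * maxAtFin v P.x ≤ _
      rw [maxAtFin, hj, two_mul, pow_add, mul_assoc]
      refine mul_le_mul h1 ((mul_le_mul_of_nonneg_right h2 (fnorm_nonneg v _)).trans
        (Finset.le_sup' (fun j => maxAtFin v P.y ^ ((a j : ℤ) : ℝ) * fnorm v (P.x j))
          (Finset.mem_univ j))) (mul_nonneg h0 (fnorm_nonneg v _)) (h0.trans h1)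
  rw [Hstd, hinf, twistHeight]
  refine le_trans (le_of_eq (by ring)) (mul_le_mul_of_nonneg_left hfin
    (mul_nonneg (Real.rpow_nonneg (infHeight_pos P.hy).le _)
      (Finset.prod_nonneg fun w _ => pow_nonneg (twistAt_nonneg a w _ _) _)))

/-- Every nonzero vector has a multiple which is integral and primitive at `v`. -/
theorem exists_integral_primitive (v : HeightOneSpectrum (𝓞 k)) {x : Fin 3 → k} (hx : x ≠ 0) :
    ∃ c : k, c ≠ 0 ∧ ∃ X : Fin 3 → 𝓞 k, (∀ j, algebraMap (𝓞 k) k (X j) = c * x j) ∧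
      ∃ j, X j ∉ v.asIdeal := by
  obtain ⟨j₀, -, hj₀⟩ := Finset.exists_max_image Finset.univ (fun j => v.valuation k (x j))
    Finset.univ_nonempty
  have hx0 : x j₀ ≠ 0 := fun h => hx <| funext fun j => by
    have := hj₀ j (Finset.mem_univ j)
    simpa [h] using this
  have hle : ∀ j, v.valuation k (x j / x j₀) ≤ 1 := fun j => by
    rw [map_div₀]
    exact div_le_one_of_le₀ (hj₀ j (Finset.mem_univ j)) zero_le
  choose N d hd using fun j => v.exists_primeCompl_mul_eq_of_integer (x j / x j₀) (hle j)
  have hmem : (∏ i, (d i : 𝓞 k)) ∉ v.asIdeal := fun h => by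
    obtain ⟨i, -, hi⟩ := (v.isPrime.prod_mem_iff).1 h
    exact (d i).2 hi
  have hD : algebraMap (𝓞 k) k (∏ i, (d i : 𝓞 k)) ≠ 0 := fun h => hmem <| by
    rw [(FaithfulSMul.algebraMap_eq_zero_iff (𝓞 k) k).1 h]
    exact v.asIdeal.zero_mem
  refine ⟨algebraMap (𝓞 k) k (∏ i, (d i : 𝓞 k)) / x j₀, div_ne_zero hD hx0, ?_⟩
  have hex : ∀ j, ∃ X : 𝓞 k, algebraMap (𝓞 k) k X =
      algebraMap (𝓞 k) k (∏ i, (d i : 𝓞 k)) / x j₀ * x j := fun j => by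
    refine ⟨N j * ∏ i ∈ Finset.univ.erase j, (d i : 𝓞 k), ?_⟩
    rw [map_mul, ← hd, ← Finset.mul_prod_erase _ _ (Finset.mem_univ j), map_mul]
    ring
  choose X hX using hex
  refine ⟨X, hX, j₀, ?_⟩
  have : X j₀ = ∏ i, (d i : 𝓞 k) := FaithfulSMul.algebraMap_injective (𝓞 k) k <| by
    rw [hX, div_mul_cancel₀ _ hx0]
  rwa [this]

section Forms

variable {a : Fin 3 → ℤ} {e : ℤ} {f : Fin 3 → Fin 3 → MvPolynomial (Fin (n + 1)) (𝓞 k)}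

theorem sum_eq_of_isHomogeneous {R σ : Type*} [CommSemiring R] [Fintype σ] {φ : MvPolynomial σ R}
    {m : ℕ} (hφ : φ.IsHomogeneous m) {d : σ →₀ ℕ} (hd : d ∈ φ.support) : ∑ i, d i = m := by
  rw [← Finsupp.degree_eq_sum, Finsupp.degree_eq_weight_one]
  exact hφ (MvPolynomial.mem_support_iff.1 hd)

theorem aeval_mul_left_of_isHomogeneous {R A σ : Type*} [CommSemiring R] [CommSemiring A]
    [Algebra R A] [Fintype σ] {φ : MvPolynomial σ R} {m : ℕ} (hφ : φ.IsHomogeneous m) (l : A)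
    (y : σ → A) : aeval (fun i => l * y i) φ = l ^ m * aeval y φ := by
  rw [aeval_def, aeval_def, eval₂_eq', eval₂_eq', Finset.mul_sum]
  refine Finset.sum_congr rfl fun d hd => ?_
  simp_rw [mul_pow, Finset.prod_mul_distrib, Finset.prod_pow_eq_pow_sum,
    sum_eq_of_isHomogeneous hφ hd]
  ring

theorem DegOK.aeval_mul_left (hf : DegOK a e f) (l : kˣ) (y : Fin (n + 1) → k) (i j : Fin 3) :
    aeval (fun t => (l : k) * y t) (f i j) = (l : k) ^ (a i + a j + e) * aeval y (f i j) := by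
  rcases lt_or_ge (a i + a j + e) 0 with h | h
  · simp [(hf i j).2.2 h]
  · rw [aeval_mul_left_of_isHomogeneous (hf i j).2.1, ← zpow_natCast, Int.toNat_of_nonneg h]

/-- Every point of the fibre above the integral point `z` has a representative above `z` which is
integral and primitive at `v`. -/
theorem exists_integral_rep (hf : DegOK a e f) {z : Fin (n + 1) → 𝓞 k} {P : PtRep k n f}
    (hP : P ∈ fiberSet f fun i => algebraMap (𝓞 k) k (z i)) (v : HeightOneSpectrum (𝓞 k)) :
    ∃ P' : PtRep k n f, ptRel a f P P' ∧ (P'.y = fun i => algebraMap (𝓞 k) k (z i)) ∧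
      ∃ X : Fin 3 → 𝓞 k, (P'.x = fun j => algebraMap (𝓞 k) k (X j)) ∧ ∃ j, X j ∉ v.asIdeal := by
  obtain ⟨l, hl⟩ := hP
  let x : Fin 3 → k := fun j => (l : k) ^ a j * P.x j
  have hx : x ≠ 0 := by
    obtain ⟨j, hj⟩ := Function.ne_iff.1 P.hx
    exact Function.ne_iff.2 ⟨j, mul_ne_zero (zpow_ne_zero _ l.ne_zero) hj⟩
  obtain ⟨c, hc, X, hX, hXv⟩ := exists_integral_primitive v hx
  have hy : (fun t => (l⁻¹ : kˣ) * P.y t) = fun i => algebraMap (𝓞 k) k (z i) := funext fun i => by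
    rw [hl, Units.inv_mul_cancel_left]
  refine ⟨⟨fun i => algebraMap (𝓞 k) k (z i), fun j => algebraMap (𝓞 k) k (X j), ?_, ?_, ?_⟩,
    ⟨l⁻¹, Units.mk0 c hc, fun i => (congr_fun hy i).symm, fun j => ?_⟩, rfl, X, rfl, hXv⟩
  · rw [← hy]
    obtain ⟨i, hi⟩ := Function.ne_iff.1 P.hy
    exact Function.ne_iff.2 ⟨i, mul_ne_zero (l⁻¹).ne_zero hi⟩
  · obtain ⟨j, hj⟩ := Function.ne_iff.1 hx
    refine Function.ne_iff.2 ⟨j, ?_⟩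
    change algebraMap (𝓞 k) k (X j) ≠ 0
    rw [hX]
    exact mul_ne_zero hc hj
  · have key : ∀ i j, aeval (fun i => algebraMap (𝓞 k) k (z i)) (f i j) *
        algebraMap (𝓞 k) k (X i) * algebraMap (𝓞 k) k (X j) =
        c ^ 2 * (l : k) ^ (-e) * (aeval P.y (f i j) * P.x i * P.x j) := fun i j => by
      rw [← hy, hf.aeval_mul_left, hX, hX]
      have : ((l⁻¹ : kˣ) : k) ^ (a i + a j + e) =
          ((l : k) ^ a i)⁻¹ * ((l : k) ^ a j)⁻¹ * (l : k) ^ (-e) := by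
        rw [Units.val_inv_eq_inv_val, inv_zpow', neg_add, neg_add, zpow_add₀ l.ne_zero,
          zpow_add₀ l.ne_zero, zpow_neg, zpow_neg]
      have h1 := zpow_ne_zero (a i) l.ne_zero
      have h2 := zpow_ne_zero (a j) l.ne_zero
      rw [this]
      simp only [x]
      field_simp
    simp_rw [key, ← Finset.mul_sum, P.hQ, mul_zero]
  · change algebraMap (𝓞 k) k (X j) = _
    rw [hX]
    simp [x]
    ring

/-- The matrix of the quadratic form defining the fibre above `z`. -/
def fibMatrix (f : Fin 3 → Fin 3 → MvPolynomial (Fin (n + 1)) (𝓞 k)) (z : Fin (n + 1) → 𝓞 k) :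
    Matrix (Fin 3) (Fin 3) (𝓞 k) := Matrix.of fun i j => eval z (f i j)

open Matrix in
theorem isotropic_of_rep {z : Fin (n + 1) → 𝓞 k} {P : PtRep k n f}
    (hy : P.y = fun i => algebraMap (𝓞 k) k (z i)) {X : Fin 3 → 𝓞 k}
    (hx : P.x = fun j => algebraMap (𝓞 k) k (X j)) : X ⬝ᵥ fibMatrix f z *ᵥ X = 0 := by
  refine FaithfulSMul.algebraMap_injective (𝓞 k) k ?_
  have hev : ∀ i j, aeval (fun i => algebraMap (𝓞 k) k (z i)) (f i j) =
      algebraMap (𝓞 k) k (eval z (f i j)) := fun i j => aeval_algebraMap_apply k z (f i j)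
  have h := P.hQ
  rw [hy, hx] at h
  rw [map_zero, ← h]
  simp_rw [hev, dotProduct, mulVec, dotProduct, Finset.mul_sum, map_sum, map_mul, fibMatrix, of_apply]
  exact Finset.sum_congr rfl fun i _ => Finset.sum_congr rfl fun j _ => by ring

theorem ptRel_of_proportional {P P' : PtRep k n f} (hy : P.y = P'.y)
    (hx : ∀ i j, P.x i * P'.x j = P.x j * P'.x i) : ptRel a f P P' := by
  obtain ⟨j, hj⟩ := Function.ne_iff.1 P.hx
  have hj' : P'.x j ≠ 0 := fun h0 => P'.hx <| funext fun i => by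
    have := hx j i
    rw [h0, mul_zero] at this
    exact (mul_eq_zero.1 this).resolve_left hj
  refine ⟨1, Units.mk0 (P'.x j / P.x j) (div_ne_zero hj' hj), fun i => by simp [hy], fun i => ?_⟩
  simp only [one_zpow, one_mul, Units.val_mk0]
  have hj0 : P.x j ≠ 0 := hj
  field_simp
  rw [mul_comm, hx j i]
  ring

theorem Ncount_le (hf : DegOK a e f) {U : Set (PtRep k n f)} {H : PtRep k n f → ℝ}
    (hHinv : ∀ P P', ptRel a f P P' → H P = H P') {z : Fin (n + 1) → 𝓞 k}
    (hz : (fun i => algebraMap (𝓞 k) k (z i)) ≠ 0) (v : HeightOneSpectrum (𝓞 k))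
    (h2 : (2 : 𝓞 k) ∉ v.asIdeal) (hΔ : DeltaO f z ∉ v.asIdeal) {B T : ℝ}
    (hT : ∀ P : PtRep k n f, (P.y = fun i => algebraMap (𝓞 k) k (z i)) → H P ≤ B →
      twistHeight a P.y P.x ≤ T) {r : ℕ}
    (hr : (∏ w : InfinitePlace k, (6 : ℝ) ^ w.mult) * T ^ 3 <
      (Ideal.absNorm v.asIdeal : ℝ) ^ (3 * r) * infHeight (fun i => algebraMap (𝓞 k) k (z i)) ^
        (((a 0 : ℤ) : ℝ) + ((a 1 : ℤ) : ℝ) + ((a 2 : ℤ) : ℝ))) :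
    Ncount a f (U ∩ fiberSet f fun i => algebraMap (𝓞 k) k (z i)) H B ≤
      54 * Ideal.absNorm v.asIdeal ^ 3 * Ideal.absNorm v.asIdeal ^ r := by
  have hrep : ∀ q : {q : Quot (ptRel a f) // ∃ P,
      P ∈ U ∩ fiberSet f (fun i => algebraMap (𝓞 k) k (z i)) ∧ H P ≤ B ∧
        Quot.mk (ptRel a f) P = q}, ∃ P' : PtRep k n f, Quot.mk (ptRel a f) P' = q ∧ H P' ≤ B ∧
      (P'.y = fun i => algebraMap (𝓞 k) k (z i)) ∧ ∃ X : Fin 3 → 𝓞 k,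
        (P'.x = fun j => algebraMap (𝓞 k) k (X j)) ∧ ∃ j, X j ∉ v.asIdeal := by
    rintro ⟨q, P, hP, hB, rfl⟩
    obtain ⟨P', hPP', h⟩ := exists_integral_rep hf hP.2 v
    exact ⟨P', (Quot.sound hPP').symm, hHinv _ _ hPP' ▸ hB, h⟩
  choose P hPq hPB hPy X hPX hXv using hrep
  refine natCard_le_of_isotropic v h2 (M := fibMatrix f z) ?_ hΔ X
    (fun t => isotropic_of_rep (hPy t) (hPX t)) hXv r (fun t hmem => ?_) fun t t' h => ?_
  · ext i j
    simp [fibMatrix, (hf i j).1]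
  · by_contra h0
    refine (pow_mul_le_prod_twistHeight a hz v (fun i => X (t i)) (fun i => hXv _) hmem h0).not_gt
      (lt_of_le_of_lt (mul_le_mul_of_nonneg_left ?_ (by positivity)) hr)
    rw [show T ^ 3 = ∏ _i : Fin 3, T by simp]
    refine Finset.prod_le_prod (fun i _ => twistHeight_nonneg a _ _) fun i _ => ?_
    have := hT _ (hPy (t i)) (hPB (t i))
    rwa [hPy, hPX] at this
  · refine Subtype.ext ?_
    rw [← hPq t, ← hPq t']
    refine Quot.sound (ptRel_of_proportional ((hPy t).trans (hPy t').symm) fun i j => ?_)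
    simp_rw [hPX, ← map_mul, h i j]

theorem infHeight_rpow_le_of_Ncount_ne_zero (hf : DegOK a e f) {U : Set (PtRep k n f)}
    {H : PtRep k n f → ℝ} (hHinv : ∀ P P', ptRel a f P P' → H P = H P')
    {z : Fin (n + 1) → 𝓞 k} (v : HeightOneSpectrum (𝓞 k)) {j : Fin 3} (hUx : ∀ P ∈ U, P.x j ≠ 0)
    {B T : ℝ} (hT : ∀ P : PtRep k n f, (P.y = fun i => algebraMap (𝓞 k) k (z i)) → H P ≤ B →
      twistHeight a P.y P.x ≤ T)
    (hN : Ncount a f (U ∩ fiberSet f fun i => algebraMap (𝓞 k) k (z i)) H B ≠ 0) :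
    infHeight (fun i => algebraMap (𝓞 k) k (z i)) ^ ((a j : ℤ) : ℝ) ≤ T := by
  obtain ⟨q, P, hP, hB, -⟩ := (Nat.card_ne_zero.1 hN).1
  obtain ⟨P', hPP', hy, -⟩ := exists_integral_rep hf hP.2 v
  have h := hT P' hy (hHinv _ _ hPP' ▸ hB)
  obtain ⟨l, m, -, hlm⟩ := hPP'
  rw [← hy]
  refine (infHeight_rpow_le_twistHeight a P'.y ?_).trans h
  rw [hlm]
  exact mul_ne_zero (Units.ne_zero _) (hUx P hP.1)

theorem apply_aeval_le {φ : MvPolynomial (Fin (n + 1)) (𝓞 k)} {m : ℕ} (hφ : φ.IsHomogeneous m)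
    (w : InfinitePlace k) (z : Fin (n + 1) → k) :
    w (aeval z φ) ≤ (∑ d ∈ φ.support, w (algebraMap (𝓞 k) k (φ.coeff d))) * maxAt w z ^ m := by
  rw [aeval_def, eval₂_eq', Finset.sum_mul]
  refine (w.1.sum_le _ _).trans (Finset.sum_le_sum fun d hd => ?_)
  change w _ ≤ _
  rw [map_mul, map_prod, ← sum_eq_of_isHomogeneous hφ hd, ← Finset.prod_pow_eq_pow_sum]
  refine mul_le_mul_of_nonneg_left (Finset.prod_le_prod (fun i _ => apply_nonneg _ _)
    fun i _ => ?_) (apply_nonneg _ _)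
  rw [map_pow]
  exact pow_le_pow_left₀ (apply_nonneg _ _) (le_maxAt w z i) _

theorem exists_apply_aeval_le (hf : DegOK a e f) : ∃ C : ℝ, 0 ≤ C ∧ ∀ (w : InfinitePlace k)
    (z : Fin (n + 1) → k) (i j : Fin 3), z ≠ 0 →
      w (aeval z (f i j)) ≤ C * maxAt w z ^ ((a i : ℝ) + a j + e) := by
  let c : InfinitePlace k → Fin 3 → Fin 3 → ℝ := fun w i j =>
    ∑ d ∈ (f i j).support, w (algebraMap (𝓞 k) k ((f i j).coeff d))
  have hc : ∀ w i j, 0 ≤ c w i j := fun w i j => Finset.sum_nonneg fun d _ => apply_nonneg _ _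
  refine ⟨∑ w, ∑ i, ∑ j, c w i j, Finset.sum_nonneg fun w _ => Finset.sum_nonneg fun i _ =>
    Finset.sum_nonneg fun j _ => hc w i j, fun w z i j hz => ?_⟩
  rcases lt_or_ge (a i + a j + e) 0 with h | h
  · rw [(hf i j).2.2 h, map_zero, map_zero]
    exact mul_nonneg (Finset.sum_nonneg fun w _ => Finset.sum_nonneg fun i _ =>
      Finset.sum_nonneg fun j _ => hc w i j) (Real.rpow_nonneg (maxAt_nonneg w z) _)
  · have h1 : (a i : ℝ) + a j + e = ((a i + a j + e).toNat : ℕ) := by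
      rw [← Int.cast_natCast (R := ℝ), Int.toNat_of_nonneg h]
      push_cast
      ring
    rw [h1, Real.rpow_natCast]
    refine (apply_aeval_le (hf i j).2.1 w z).trans (mul_le_mul_of_nonneg_right ?_
      (pow_nonneg (maxAt_nonneg w z) _))
    calc c w i j ≤ ∑ j, c w i j :=
        Finset.single_le_sum (f := fun j => c w i j) (fun j _ => hc w i j) (Finset.mem_univ j)
      _ ≤ ∑ i, ∑ j, c w i j := Finset.single_le_sum (f := fun i => ∑ j, c w i j)
        (fun i _ => Finset.sum_nonneg fun j _ => hc w i j) (Finset.mem_univ i)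
      _ ≤ ∑ w, ∑ i, ∑ j, c w i j := Finset.single_le_sum (f := fun w => ∑ i, ∑ j, c w i j)
        (fun w _ => Finset.sum_nonneg fun i _ => Finset.sum_nonneg fun j _ => hc w i j)
        (Finset.mem_univ w)

/-- The discriminant is polynomially bounded in terms of the height. -/
theorem exists_abs_norm_DeltaO_le (hf : DegOK a e f) : ∃ C : ℝ, 0 < C ∧ ∃ D : ℝ,
    ∀ z : Fin (n + 1) → 𝓞 k, (fun i => algebraMap (𝓞 k) k (z i)) ≠ 0 →
      ((Algebra.norm ℤ (DeltaO f z)).natAbs : ℝ) ≤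
        C * infHeight (fun i => algebraMap (𝓞 k) k (z i)) ^ D := by
  obtain ⟨C, hC, h⟩ := exists_apply_aeval_le hf
  let D : ℝ := 2 * ((a 0 : ℝ) + a 1 + a 2) + 3 * e
  refine ⟨∏ w : InfinitePlace k, (6 * C ^ 3 + 1) ^ w.mult, by positivity, D, fun z hz => ?_⟩
  have hev : algebraMap (𝓞 k) k (DeltaO f z) = Matrix.det
      (Matrix.of fun i j => aeval (fun i => algebraMap (𝓞 k) k (z i)) (f i j)) := by
    rw [DeltaO, RingHom.map_det]
    congr 1
    ext i j
    exact (aeval_algebraMap_apply k z (f i j)).symm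
  have hnorm : ((Algebra.norm ℤ (DeltaO f z)).natAbs : ℝ) =
      ∏ w : InfinitePlace k, w (algebraMap (𝓞 k) k (DeltaO f z)) ^ w.mult := by
    rw [InfinitePlace.prod_eq_abs_norm, Nat.cast_natAbs, Int.cast_abs]
    rw [show algebraMap (𝓞 k) k (DeltaO f z) = ((DeltaO f z : 𝓞 k) : k) from rfl,
      ← Algebra.coe_norm_int]
    push_cast
    rfl
  rw [hnorm, infHeight_rpow, ← Finset.prod_mul_distrib]
  refine Finset.prod_le_prod (fun w _ => pow_nonneg (apply_nonneg _ _) _) fun w _ => ?_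
  rw [← mul_pow]
  refine pow_le_pow_left₀ (apply_nonneg _ _) ?_ _
  have hZ := maxAt_pos w hz
  have hD := Real.rpow_nonneg hZ.le D
  rw [hev]
  calc _ ≤ _ := apply_det_le w _
    _ ≤ ∑ σ : Equiv.Perm (Fin 3), C ^ 3 * maxAt w (fun i => algebraMap (𝓞 k) k (z i)) ^ D := by
      refine Finset.sum_le_sum fun σ _ => ?_
      refine (Finset.prod_le_prod (fun i _ => apply_nonneg _ _)
        fun i _ => h w _ (σ i) i hz).trans_eq ?_
      rw [Finset.prod_mul_distrib, Finset.prod_const, Finset.card_fin,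
        ← Real.rpow_sum_of_pos hZ, Finset.sum_add_distrib, Finset.sum_add_distrib,
        Equiv.sum_comp σ fun i => (a i : ℝ)]
      simp only [Fin.sum_univ_three, D]
      ring_nf
    _ = 6 * C ^ 3 * maxAt w (fun i => algebraMap (𝓞 k) k (z i)) ^ D := by
      rw [Finset.sum_const, Finset.card_univ, Fintype.card_perm, nsmul_eq_mul]
      norm_num [Nat.factorial]
      ring
    _ ≤ _ := by nlinarith

end Forms

/-- A prime of small norm avoiding a given nonzero natural number. -/
theorem exists_heightOneSpectrum_pow_le (k : Type) [Field k] [NumberField k] (s : ℕ) {ε : ℝ}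
    (hε : 0 < ε) : ∃ C : ℝ, 0 < C ∧ ∀ m : ℕ, m ≠ 0 → ∃ v : HeightOneSpectrum (𝓞 k),
      (m : 𝓞 k) ∉ v.asIdeal ∧ (Ideal.absNorm v.asIdeal : ℝ) ^ s ≤ C * (m : ℝ) ^ ε := by
  let d := Module.finrank ℤ (𝓞 k)
  obtain ⟨K, hK⟩ := exists_nat_ge ((s * d : ℕ) / ε)
  rw [div_le_iff₀ hε] at hK
  obtain ⟨C, hC, h⟩ := exists_prime_not_dvd_pow_le K
  refine ⟨(C : ℝ) ^ ε, by positivity, fun m hm => ?_⟩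
  obtain ⟨p, hp, hpm, hpK⟩ := h m hm
  have hpu : Ideal.span {(p : 𝓞 k)} ≠ ⊤ := fun h => by
    have := Ideal.absNorm_span_natCast (S := 𝓞 k) p
    rw [h, Ideal.absNorm_top] at this
    exact (one_lt_pow₀ hp.one_lt Module.finrank_pos.ne').ne this
  obtain ⟨M, hM, hpM⟩ := Ideal.exists_le_maximal _ hpu
  have hp0 : (p : 𝓞 k) ≠ 0 := Nat.cast_ne_zero.2 hp.ne_zero
  have hpM' : (p : 𝓞 k) ∈ M := hpM (Ideal.mem_span_singleton_self _)
  refine ⟨⟨M, hM.isPrime, fun h => hp0 (by simpa [h] using hpM')⟩, fun hmM => ?_, ?_⟩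
  · have hcop : IsCoprime (m : ℤ) p := Nat.isCoprime_iff_coprime.2
      ((Nat.Prime.coprime_iff_not_dvd hp).2 hpm).symm
    obtain ⟨u, w, huw⟩ := hcop
    refine hM.ne_top ((Ideal.eq_top_iff_one _).2 ?_)
    have h1 : (u : 𝓞 k) * m + w * p = 1 := by exact_mod_cast congrArg (Int.cast : ℤ → 𝓞 k) huw
    rw [← h1]
    exact M.add_mem (M.mul_mem_left _ hmM) (M.mul_mem_left _ hpM')
  · have hN : Ideal.absNorm M ≤ p ^ d := by
      refine Nat.le_of_dvd (pow_pos hp.pos _) ?_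
      rw [← Ideal.absNorm_span_natCast (S := 𝓞 k)]
      exact Ideal.absNorm_dvd_absNorm_of_le hpM
    have hp1 : (1 : ℝ) ≤ p := by exact_mod_cast hp.one_le
    calc (Ideal.absNorm M : ℝ) ^ s ≤ ((p : ℝ) ^ d) ^ s :=
          pow_le_pow_left₀ (by positivity) (by exact_mod_cast hN) _
      _ = (p : ℝ) ^ ((s * d : ℕ) : ℝ) := by rw [Real.rpow_natCast, ← pow_mul, mul_comm]
      _ ≤ (p : ℝ) ^ ((K : ℝ) * ε) := Real.rpow_le_rpow_of_exponent_le hp1 hK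
      _ = ((p : ℝ) ^ K) ^ ε := by rw [Real.rpow_mul (by positivity), Real.rpow_natCast]
      _ ≤ ((C : ℝ) * m) ^ ε :=
          Real.rpow_le_rpow (by positivity) (by exact_mod_cast hpK) hε.le
      _ = _ := Real.mul_rpow (by positivity) (by positivity)

theorem one_le_infHeight {z : Fin (n + 1) → 𝓞 k}
    (hz : (fun i => algebraMap (𝓞 k) k (z i)) ≠ 0) :
    1 ≤ infHeight fun i => algebraMap (𝓞 k) k (z i) := by
  obtain ⟨i, hi⟩ := Function.ne_iff.1 hz
  have hi0 : z i ≠ 0 := fun h => hi (by simp [h])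
  calc (1 : ℝ) ≤ ((Algebra.norm ℤ (z i)).natAbs : ℝ) := by
        exact_mod_cast Int.natAbs_pos.2 (Algebra.norm_ne_zero_iff.2 hi0)
    _ = ∏ w : InfinitePlace k, w (algebraMap (𝓞 k) k (z i)) ^ w.mult := by
        rw [InfinitePlace.prod_eq_abs_norm, Nat.cast_natAbs, Int.cast_abs]
        rw [show algebraMap (𝓞 k) k (z i) = ((z i : 𝓞 k) : k) from rfl, ← Algebra.coe_norm_int]
        push_cast
        rfl
    _ ≤ _ := Finset.prod_le_prod (fun w _ => pow_nonneg (apply_nonneg _ _) _) fun w _ =>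
        pow_le_pow_left₀ (apply_nonneg _ _) (le_maxAt w (fun i => algebraMap (𝓞 k) k (z i)) i) _

/-- A prime of good reduction for the conic `X_z`, of norm `≪_ε` the `ε`-th power of the height. -/
theorem exists_good_prime {a : Fin 3 → ℤ} {e : ℤ}
    {f : Fin 3 → Fin 3 → MvPolynomial (Fin (n + 1)) (𝓞 k)} (hf : DegOK a e f) (s : ℕ) {ε : ℝ}
    (hε : 0 < ε) : ∃ C : ℝ, 0 < C ∧ ∀ z : Fin (n + 1) → 𝓞 k,
      (fun i => algebraMap (𝓞 k) k (z i)) ≠ 0 → DeltaO f z ≠ 0 →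
      ∃ v : HeightOneSpectrum (𝓞 k), (2 : 𝓞 k) ∉ v.asIdeal ∧ DeltaO f z ∉ v.asIdeal ∧
        (Ideal.absNorm v.asIdeal : ℝ) ^ s ≤
          C * infHeight (fun i => algebraMap (𝓞 k) k (z i)) ^ ε := by
  obtain ⟨C₁, hC₁, D, hD⟩ := exists_abs_norm_DeltaO_le hf
  have hε' : 0 < ε / (|D| + 1) := by positivity
  obtain ⟨C₂, hC₂, h⟩ := exists_heightOneSpectrum_pow_le k s hε'
  refine ⟨C₂ * (2 * C₁) ^ (ε / (|D| + 1)), by positivity, fun z hz hΔ => ?_⟩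
  have hh := one_le_infHeight hz
  set h' := infHeight fun i => algebraMap (𝓞 k) k (z i)
  obtain ⟨v, hv, hvN⟩ := h (2 * (Algebra.norm ℤ (DeltaO f z)).natAbs)
    (mul_ne_zero two_ne_zero (Int.natAbs_ne_zero.2 (Algebra.norm_ne_zero_iff.2 hΔ)))
  rw [Nat.cast_mul, Nat.cast_ofNat] at hv
  refine ⟨v, fun h2 => hv (Ideal.mul_mem_right _ _ h2),
    fun hΔv => hv (Ideal.mul_mem_left _ _ ?_), hvN.trans ?_⟩
  · rw [← Ideal.absNorm_span_singleton]
    exact (Ideal.span_singleton_le_iff_mem _).2 hΔv (Ideal.absNorm_mem _)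
  · rw [mul_assoc]
    refine mul_le_mul_of_nonneg_left ?_ hC₂.le
    push_cast
    calc _ ≤ (2 * C₁ * h' ^ D) ^ (ε / (|D| + 1)) := by
          refine Real.rpow_le_rpow (by positivity) ?_ hε'.le
          rw [mul_assoc]
          exact mul_le_mul_of_nonneg_left (hD z hz) two_pos.le
      _ = (2 * C₁) ^ (ε / (|D| + 1)) * h' ^ (D * (ε / (|D| + 1))) := by
          rw [Real.mul_rpow (by positivity) (by positivity), Real.rpow_mul (by positivity)]
      _ ≤ _ := by
          refine mul_le_mul_of_nonneg_left (Real.rpow_le_rpow_of_exponent_le hh ?_) (by positivity)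
          rw [mul_div_left_comm]
          refine mul_le_of_le_one_right hε.le ((div_le_one (by positivity)).2 ?_)
          linarith [le_abs_self D]

theorem exists_lt_pow_le {N : ℝ} (hN : 1 < N) {u : ℝ} (hu : 0 ≤ u) :
    ∃ r : ℕ, u < N ^ r ∧ N ^ r ≤ N * (1 + u) := by
  classical
  have hex := pow_unbounded_of_one_lt u hN
  refine ⟨Nat.find hex, Nat.find_spec hex, ?_⟩
  rcases h : Nat.find hex with _ | r
  · rw [pow_zero]
    nlinarith
  · have := not_lt.1 (Nat.find_min hex (m := r) (by omega))
    rw [pow_succ']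
    exact mul_le_mul_of_nonneg_left (by linarith) (by linarith)

theorem exists_rpow_le_mul_rpow {θ : ℝ} (hθ : 0 < θ) (s : ℝ) :
    ∃ C : ℝ, 0 < C ∧ ∀ x y : ℝ, 0 < y → y ≤ x → θ * x ≤ y → x ^ s ≤ C * y ^ s := by
  refine ⟨max 1 (θ⁻¹ ^ s), by positivity, fun x y hy hyx hxy => ?_⟩
  rcases le_total 0 s with hs | hs
  · calc x ^ s ≤ (θ⁻¹ * y) ^ s := Real.rpow_le_rpow (hy.trans_le hyx).le
          (by rwa [le_inv_mul_iff₀ hθ]) hs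
      _ = θ⁻¹ ^ s * y ^ s := Real.mul_rpow (by positivity) hy.le
      _ ≤ _ := mul_le_mul_of_nonneg_right (le_max_right _ _) (by positivity)
  · calc x ^ s ≤ 1 * y ^ s := by
          rw [one_mul]
          exact Real.rpow_le_rpow_of_nonpos hy hyx hs
      _ ≤ _ := mul_le_mul_of_nonneg_right (le_max_left _ _) (by positivity)

/-- The bound for the number of points on a fibre, with `infHeight` in place of `Hproj`. -/
theorem exists_Ncount_le {a : Fin 3 → ℤ} {e : ℤ}
    {f : Fin 3 → Fin 3 → MvPolynomial (Fin (n + 1)) (𝓞 k)} (hf : DegOK a e f) (α : ℚ)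
    {U : Set (PtRep k n f)} {H : PtRep k n f → ℝ} (hHinv : ∀ P P', ptRel a f P P' → H P = H P')
    {c : ℝ} (hc : 0 < c) (hH : ∀ P, c * Hstd a e α f P ≤ H P) (hUx : ∀ P ∈ U, P.x 2 ≠ 0)
    {b : 𝓞 k} (hb0 : b ≠ 0) {ε : ℝ} (hε : 0 < ε) :
    ∃ C : ℝ, 0 < C ∧ ∀ z : Fin (n + 1) → 𝓞 k, (fun i => algebraMap (𝓞 k) k (z i)) ≠ 0 →
      DeltaO f z ≠ 0 → b ∈ Ideal.span (Set.range z) → ∀ B : ℝ, 0 < B →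
        (Ncount a f (U ∩ fiberSet f fun i => algebraMap (𝓞 k) k (z i)) H B : ℝ) / B ≤
          C * (infHeight (fun i => algebraMap (𝓞 k) k (z i)) ^
                  (-((((a 0 : ℤ) : ℝ) + ((a 1 : ℤ) : ℝ) + ((a 2 : ℤ) : ℝ)) / 3
                      + Aexp n a e α) + ε) +
                infHeight (fun i => algebraMap (𝓞 k) k (z i)) ^
                  (-(Aexp n a e α + ((a 2 : ℤ) : ℝ)) + ε)) := by
  obtain ⟨C₁, hC₁, hprime⟩ := exists_good_prime hf 4 hε
  obtain ⟨K, hK⟩ := exists_nat_ge (max (Aexp n a e α)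
    (Finset.univ.sup' Finset.univ_nonempty fun j => ((a j : ℤ) : ℝ)))
  have hKA := (le_max_left _ _).trans hK
  have hKa : ∀ j, ((a j : ℤ) : ℝ) ≤ K := fun j =>
    (Finset.le_sup' (fun j => ((a j : ℤ) : ℝ)) (Finset.mem_univ j)).trans
      ((le_max_right _ _).trans hK)
  set A := Aexp n a e α
  set σ : ℝ := ((a 0 : ℤ) : ℝ) + ((a 1 : ℤ) : ℝ) + ((a 2 : ℤ) : ℝ)
  let θ := c * finAbs (algebraMap (𝓞 k) k b) ^ (2 * K)
  have hθ : 0 < θ := mul_pos hc (pow_pos (finAbs_pos (by simpa using hb0)) _)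
  let c₆ : ℝ := ∏ w : InfinitePlace k, (6 : ℝ) ^ w.mult
  have hc₆ : 1 ≤ c₆ := 
    Finset.one_le_prod fun w _ => one_le_pow₀ (by norm_num : (1 : ℝ) ≤ 6)
  refine ⟨54 * C₁ * (c₆ / θ), by positivity, fun z hz hΔ hb B hB => ?_⟩
  obtain ⟨v, h2, hΔv, hvN⟩ := hprime z hz hΔ
  have hh := infHeight_pos hz
  set h := infHeight fun i => algebraMap (𝓞 k) k (z i)
  set N : ℝ := (Ideal.absNorm v.asIdeal : ℝ) with hN
  let T := B / (θ * h ^ A)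
  have hT0 : 0 < T := by positivity
  have hT : ∀ P : PtRep k n f, (P.y = fun i => algebraMap (𝓞 k) k (z i)) → H P ≤ B →
      twistHeight a P.y P.x ≤ T := fun P hP hPB => by
    have h1 := mul_twistHeight_le_Hstd a e α f hKA hKa hb0 hb P hP
    rw [show infHeight P.y = h by rw [hP]] at h1
    rw [le_div_iff₀ (by positivity)]
    calc _ = c * (finAbs (algebraMap (𝓞 k) k b) ^ (2 * K) *
          (h ^ A * twistHeight a P.y P.x)) := by simp only [θ]; ring
      _ ≤ B := ((mul_le_mul_of_nonneg_left h1 hc.le).trans (hH P)).trans hPB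
  have hN1 : 1 < N := by
    have : Ideal.absNorm v.asIdeal ≠ 1 := fun h => v.isPrime.ne_top (Ideal.absNorm_eq_one_iff.1 h)
    have : Ideal.absNorm v.asIdeal ≠ 0 := fun h => v.ne_bot (Ideal.absNorm_eq_zero_iff.1 h)
    have : 1 < Ideal.absNorm v.asIdeal := by omega
    exact Nat.one_lt_cast.2 this
  let u := c₆ * (T * h ^ (-(σ / 3)))
  have hu : 0 ≤ u := by positivity
  obtain ⟨r, hr, hr'⟩ := exists_lt_pow_le hN1 hu
  have hcount : (Ncount a f (U ∩ fiberSet f fun i => algebraMap (𝓞 k) k (z i)) H B : ℝ) ≤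
      54 * N ^ 3 * N ^ r := by
    have h3 : (h ^ (-(σ / 3))) ^ 3 * h ^ σ = 1 := by
      rw [← Real.rpow_natCast, ← Real.rpow_mul hh.le, ← Real.rpow_add hh, Nat.cast_ofNat,
        show -(σ / 3) * 3 + σ = 0 by ring, Real.rpow_zero]
    have hlt : c₆ * T ^ 3 < N ^ (3 * r) * h ^ σ := calc
      c₆ * T ^ 3 ≤ c₆ ^ 3 * T ^ 3 :=
        mul_le_mul_of_nonneg_right (le_self_pow₀ hc₆ three_ne_zero) (by positivity)
      _ = u ^ 3 * h ^ σ := by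
        simp only [u]
        linear_combination (-(c₆ ^ 3 * T ^ 3)) * h3
      _ < (N ^ r) ^ 3 * h ^ σ := by gcongr
      _ = N ^ (3 * r) * h ^ σ := by rw [← pow_mul, mul_comm r]
    have h1 := Ncount_le hf (U := U) hHinv hz v h2 hΔv hT hlt
    rw [hN]
    exact_mod_cast h1
  rcases eq_or_ne (Ncount a f (U ∩ fiberSet f fun i => algebraMap (𝓞 k) k (z i)) H B) 0
    with h0 | h0
  · rw [h0, Nat.cast_zero, zero_div]
    positivity
  have h2T : 1 ≤ T * h ^ (-((a 2 : ℤ) : ℝ)) := by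
    rw [Real.rpow_neg hh.le, ← div_eq_mul_inv, one_le_div (by positivity)]
    exact infHeight_rpow_le_of_Ncount_ne_zero hf hHinv v hUx hT h0
  rw [div_le_iff₀ hB]
  have e1 : h ^ (-(σ / 3 + A) + ε) = h ^ ε * (h ^ A)⁻¹ * h ^ (-(σ / 3)) := by
    rw [← Real.rpow_neg hh.le, ← Real.rpow_add hh, ← Real.rpow_add hh]
    ring_nf
  have e2 : h ^ (-(A + ((a 2 : ℤ) : ℝ)) + ε) = h ^ ε * (h ^ A)⁻¹ * h ^ (-((a 2 : ℤ) : ℝ)) := by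
    rw [← Real.rpow_neg hh.le, ← Real.rpow_add hh, ← Real.rpow_add hh]
    ring_nf
  calc _ ≤ 54 * N ^ 3 * (N * (1 + u)) :=
        hcount.trans (mul_le_mul_of_nonneg_left hr' (by positivity))
    _ = 54 * N ^ 4 * (1 + u) := by ring
    _ ≤ 54 * (C₁ * h ^ ε) * (c₆ * (T * h ^ (-((a 2 : ℤ) : ℝ))) + u) := by
        have : 1 ≤ c₆ * (T * h ^ (-((a 2 : ℤ) : ℝ))) := one_le_mul_of_one_le_of_one_le hc₆ h2T
        gcongr
    _ = _ := by
        rw [e1, e2]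
        simp only [u, T]
        field_simp
        ring

/-- Lemma 3.7 / `lem:y_height_bound`: the fibre-wise upper bound
`N(X_y ∩ U, H, B)/B ≪_ε H(y)^{-((a₀+a₁+a₂)/3+A)+ε} + H(y)^{-(A+a₂)+ε}`. -/
theorem statement_10
    (k : Type) [Field k] [NumberField k]
    (n : ℕ) (hn : 1 ≤ n)
    (a : Fin 3 → ℤ) (ha : a 0 ≤ a 1 ∧ a 1 ≤ a 2) (e : ℤ)
    (f : Fin 3 → Fin 3 → MvPolynomial (Fin (n + 1)) (𝓞 k))
    (hf : DegOK a e f) (hsmooth : IsSmoothX f)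
    -- a fixed finite set of integral ideals representing the ideal classes of `k`:
    (𝒞 : Finset (Ideal (𝓞 k))) (h𝒞 : ∀ I ∈ 𝒞, I ≠ ⊥)
    (α : ℚ) (hα : (e : ℚ) + 2 * (((a 0 : ℚ) + (a 1 : ℚ) + (a 2 : ℚ)) / 3) < α)
    (H : PtRep k n f → ℝ)
    (hHpos : ∀ P, 0 < H P)
    (hHinv : ∀ P P', ptRel a f P P' → H P = H P')
    (hH : ∃ c₁ c₂ : ℝ, 0 < c₁ ∧ c₁ ≤ c₂ ∧ ∀ P,
      c₁ * Hstd a e α f P ≤ H P ∧ H P ≤ c₂ * Hstd a e α f P)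
    (U : Set (PtRep k n f))
    (ι : Type) (g : ι → MvPolynomial (Fin (n + 1) ⊕ Fin 3) k)
    (hg : ∀ i, IsBihom a (g i))
    (hUopen : U = {P | ∃ i, eval (Sum.elim P.y P.x) (g i) ≠ 0})
    (hUne : U.Nonempty)
    (hUΔ : ∀ P ∈ U, Deltak f P.y ≠ 0)
    (hUx : ∀ P ∈ U, P.x 2 ≠ 0) :
    ∀ ε : ℝ, 0 < ε → ∃ C : ℝ, 0 < C ∧
      ∀ (z : Fin (n + 1) → 𝓞 k), DeltaO f z ≠ 0 →
        Ideal.span (Set.range z) ∈ 𝒞 →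
        ∀ B : ℝ, 0 < B →
          (Ncount a f (U ∩ fiberSet f fun i => algebraMap (𝓞 k) k (z i)) H B : ℝ) / B ≤
            C * (Hproj (fun i => algebraMap (𝓞 k) k (z i)) ^
                  (-(((((a 0 : ℤ) : ℝ) + ((a 1 : ℤ) : ℝ) + ((a 2 : ℤ) : ℝ)) / 3)
                      + Aexp n a e α) + ε) +
                Hproj (fun i => algebraMap (𝓞 k) k (z i)) ^
                  (-(Aexp n a e α + ((a 2 : ℤ) : ℝ)) + ε)) := by
  intro ε hε
  obtain ⟨c₁, _, hc₁, _, hH'⟩ := hH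
  let b : ℕ := ∏ I ∈ 𝒞, Ideal.absNorm I
  have hb0 : (b : 𝓞 k) ≠ 0 := Nat.cast_ne_zero.2 <| Finset.prod_ne_zero_iff.2 fun I hI h0 =>
    h𝒞 I hI (Ideal.absNorm_eq_zero_iff.1 h0)
  obtain ⟨C, hC, h⟩ := exists_Ncount_le hf α hHinv hc₁ (fun P => (hH' P).1) hUx hb0 hε
  have hθ := finAbs_pos (x := algebraMap (𝓞 k) k b) (by simpa using hb0)
  obtain ⟨C₁, hC₁, h₁⟩ := exists_rpow_le_mul_rpow hθ
    (-(((((a 0 : ℤ) : ℝ) + ((a 1 : ℤ) : ℝ) + ((a 2 : ℤ) : ℝ)) / 3) + Aexp n a e α) + ε)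
  obtain ⟨C₂, hC₂, h₂⟩ := exists_rpow_le_mul_rpow hθ (-(Aexp n a e α + ((a 2 : ℤ) : ℝ)) + ε)
  refine ⟨C * (C₁ + C₂), by positivity, fun z hΔ hz𝒞 B hB => ?_⟩
  have hz : (fun i => algebraMap (𝓞 k) k (z i)) ≠ 0 := fun h0 => h𝒞 _ hz𝒞 <| by
    rw [Ideal.span_eq_bot]
    rintro _ ⟨i, rfl⟩
    simpa using congrFun h0 i
  have hb : (b : 𝓞 k) ∈ Ideal.span (Set.range z) := by
    obtain ⟨d, hd⟩ := Finset.dvd_prod_of_mem (fun I : Ideal (𝓞 k) => Ideal.absNorm I) hz𝒞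
    rw [show b = _ from hd, Nat.cast_mul]
    exact Ideal.mul_mem_right _ _ (Ideal.absNorm_mem _)
  have hle := Hproj_le_infHeight hz
  have hge := finAbs_mul_infHeight_le_Hproj hz hb0 hb
  have hpos := (mul_pos hθ (infHeight_pos hz)).trans_le hge
  refine (h z hz hΔ hb B hB).trans ?_
  rw [mul_assoc]
  refine mul_le_mul_of_nonneg_left ?_ hC.le
  have i1 := h₁ _ _ hpos hle hge
  have i2 := h₂ _ _ hpos hle hge
  have p1 := Real.rpow_nonneg hpos.le
    (-(((((a 0 : ℤ) : ℝ) + ((a 1 : ℤ) : ℝ) + ((a 2 : ℤ) : ℝ)) / 3) + Aexp n a e α) + ε)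
  have p2 := Real.rpow_nonneg hpos.le (-(Aexp n a e α + ((a 2 : ℤ) : ℝ)) + ε)
  refine (add_le_add i1 i2).trans ?_
  nlinarith [mul_nonneg hC₂.le p1, mul_nonneg hC₁.le p2]

end Stmt
end
end

section
/- Suppose n = 1. There exists a constant C > 0 (depending on k, 𝒞, and the f_{i,j}) such that for every (y₀,y₁) ∈ O_k² ∖ {(0,0)} with y₀O_k + y₁O_k ∈ 𝒞, the ideal Δ₀(y₀,y₁) is nonzero and 𝔑(Δ₀(y₀,y₁)) ≤ C. -/
/-!
Setup (Frei–Loughran, "Rational points and non-anticanonical height functions",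
§2–§3): `k` a number field, `X ⊂ F_n(a₀,a₁,a₂)` a smooth hypersurface of
bidegree `(e,2)` cut out by `Q(y,x) = ∑ f_{i,j}(y) xᵢ xⱼ`, with projection
`π : X → ℙⁿ`, discriminant `Δ(y) = det (f_{i,j}(y))`, and standard height `H*`
associated to the `ℚ`-divisor `-K_X + αF`.
-/

noncomputable section

open MvPolynomial NumberField Filter Topology IsDedekindDomain

namespace Stmt

variable (k : Type) [Field k] [NumberField k] (n : ℕ)

variable {k n}

/-- The ideal `Δ₀(𝐲) ⊆ O_k` generated by the `2×2` minors of the matrix `(f_{i,j}(𝐲))`. -/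
def minorsIdeal (f : Fin 3 → Fin 3 → MvPolynomial (Fin (n + 1)) (𝓞 k))
    (z : Fin (n + 1) → 𝓞 k) : Ideal (𝓞 k) :=
  Ideal.span {d | ∃ i₀ i₁ j₀ j₁ : Fin 3, i₀ ≠ i₁ ∧ j₀ ≠ j₁ ∧
    d = eval z (f i₀ j₀) * eval z (f i₁ j₁) - eval z (f i₀ j₁) * eval z (f i₁ j₀)}

/-- A nonzero matrix with vanishing `2×2` minors is determined, up to scaling of the rows,
by a single row; hence its kernel contains the kernel of a linear form. -/
lemma exists_row_of_minors_eq_zero {K : Type*} [Field K] (M : Fin 3 → Fin 3 → K)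
    (hM : ∀ i₀ i₁ j₀ j₁, i₀ ≠ i₁ → j₀ ≠ j₁ → M i₀ j₀ * M i₁ j₁ - M i₀ j₁ * M i₁ j₀ = 0) :
    ∃ r : Fin 3 → K, ∀ x : Fin 3 → K, ∑ j, r j * x j = 0 → ∀ i, ∑ j, M i j * x j = 0 := by
  by_cases h : ∃ i₀ j₀, M i₀ j₀ ≠ 0
  · obtain ⟨i₀, j₀, h₀⟩ := h
    refine ⟨M i₀, fun x hx i => ?_⟩
    have key : ∀ j, M i₀ j₀ * M i j = M i j₀ * M i₀ j := by
      intro j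
      by_cases hi : i₀ = i
      · rw [hi, mul_comm]
      by_cases hj : j₀ = j
      · rw [hj, mul_comm]
      linear_combination hM i₀ i j₀ j hi hj
    apply (mul_eq_zero.mp _).resolve_left h₀
    calc M i₀ j₀ * ∑ j, M i j * x j = ∑ j, M i₀ j₀ * M i j * x j := by
          simp only [Finset.mul_sum, mul_assoc]
      _ = M i j₀ * ∑ j, M i₀ j * x j := by simp only [key, Finset.mul_sum, mul_assoc]
      _ = 0 := by rw [hx, mul_zero]
  · push Not at h
    exact ⟨0, fun x _ i => by simp [h]⟩

/-- Over an algebraically closed field, a line and a conic in the projective plane meet. -/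
lemma exists_line_inter_conic {K : Type*} [Field K] [IsAlgClosed K] [CharZero K]
    (r : Fin 3 → K) (G : Fin 3 → Fin 3 → K) :
    ∃ x : Fin 3 → K, x ≠ 0 ∧ ∑ j, r j * x j = 0 ∧ ∑ i, ∑ j, G i j * x i * x j = 0 := by
  let φ : (Fin 3 → K) →ₗ[K] K := ∑ j, r j • LinearMap.proj j
  have hφ : ∀ x, φ x = ∑ j, r j * x j := fun x => by simp [φ]
  have hdim : 1 < Module.finrank K (LinearMap.ker φ) := by
    have h1 := φ.finrank_range_add_finrank_ker
    have h2 := Submodule.finrank_le (LinearMap.range φ)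
    simp only [Module.finrank_fin_fun, Module.finrank_self] at h1 h2
    omega
  have : Nontrivial (LinearMap.ker φ) := Module.nontrivial_of_finrank_pos (R := K) (by omega)
  obtain ⟨u, hu⟩ := exists_ne (0 : LinearMap.ker φ)
  obtain ⟨v, huv⟩ := exists_linearIndependent_pair_of_one_lt_finrank hdim hu
  let B (x y : Fin 3 → K) : K := ∑ i, ∑ j, G i j * x i * y j
  have hB : ∀ s : K, B (s • u + v) (s • u + v) =
      B u u * (s * s) + (B u v + B v u) * s + B v v := by
    intro s
    simp only [B, Pi.add_apply, Pi.smul_apply, smul_eq_mul, Fin.sum_univ_three]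
    ring
  by_cases hA : B u u = 0
  · exact ⟨u, fun h => hu (Subtype.ext h), (hφ u).symm.trans u.2, hA⟩
  · obtain ⟨d, hd⟩ := IsAlgClosed.exists_pow_nat_eq
      (discrim (B u u) (B u v + B v u) (B v v)) (n := 2) (by norm_num)
    obtain ⟨s, hs⟩ := exists_quadratic_eq_zero hA ⟨d, by rw [← hd, sq]⟩
    refine ⟨s • u + v, fun h => ?_, (hφ _).symm.trans (s • u + v).2, (hB s).trans hs⟩
    have := LinearIndependent.pair_iff.mp huv s 1 (by rw [one_smul]; exact Subtype.ext h)
    exact one_ne_zero this.2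

section Smooth

variable {k : Type} [Field k] {n : ℕ}
  {f : Fin 3 → Fin 3 → MvPolynomial (Fin (n + 1)) (𝓞 k)}
  (y : Fin (n + 1) → AlgebraicClosure k) (x : Fin 3 → AlgebraicClosure k)

lemma aeval_Qk : aeval (Sum.elim y x) (Qk f) =
    ∑ i, ∑ j, aeval y (map (algebraMap (𝓞 k) k) (f i j)) * x i * x j := by
  simp [Qk, aeval_rename, Sum.elim_comp_inl]

lemma aeval_pderiv_inl_Qk (s : Fin (n + 1)) : aeval (Sum.elim y x) (pderiv (Sum.inl s) (Qk f)) =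
    ∑ i, ∑ j, aeval y (pderiv s (map (algebraMap (𝓞 k) k) (f i j))) * x i * x j := by
  simp only [Qk, map_sum, pderiv_mul, pderiv_rename Sum.inl_injective]
  refine Finset.sum_congr rfl fun i _ => Finset.sum_congr rfl fun j _ => ?_
  simp [aeval_rename, Sum.elim_comp_inl, pderiv_X]

lemma pderiv_inr_rename_inl (s : Fin 3) (p : MvPolynomial (Fin (n + 1)) k) :
    pderiv (Sum.inr s : Fin (n + 1) ⊕ Fin 3) (rename Sum.inl p) = 0 := by
  classical
  apply pderiv_eq_zero_of_notMem_vars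
  intro h
  simpa using vars_rename _ _ h

lemma aeval_pderiv_inr_Qk (hf : ∀ i j, f i j = f j i) (s : Fin 3) :
    aeval (Sum.elim y x) (pderiv (Sum.inr s) (Qk f)) =
      2 * ∑ j, aeval y (map (algebraMap (𝓞 k) k) (f s j)) * x j := by
  have h : aeval (Sum.elim y x) (pderiv (Sum.inr s) (Qk f)) =
      ∑ i, ∑ j, (aeval y (map (algebraMap (𝓞 k) k) (f i j)) * (if i = s then 1 else 0) * x j +
        aeval y (map (algebraMap (𝓞 k) k) (f i j)) * x i * (if j = s then 1 else 0)) := by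
    simp only [Qk, map_sum, pderiv_mul, pderiv_inr_rename_inl]
    refine Finset.sum_congr rfl fun i _ => Finset.sum_congr rfl fun j _ => ?_
    simp only [pderiv_X, Pi.single_apply, Sum.inr.injEq, map_add, map_mul, aeval_rename,
      Sum.elim_comp_inl, aeval_X, Sum.elim_inr, zero_mul, zero_add]
    split_ifs <;> simp only [map_one, map_zero]
  rw [h, two_mul]
  simp only [Finset.sum_add_distrib]
  congr 1
  · simp
  · simp only [mul_ite, mul_one, mul_zero, Finset.sum_ite_eq', Finset.mem_univ, if_true]
    exact Finset.sum_congr rfl fun i _ => by rw [hf]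

/-- Euler's identity for the coefficients `f_{i,j}`. -/
lemma sum_mul_aeval_pderiv {a : Fin 3 → ℤ} {e : ℤ} (hf : DegOK a e f) (i j : Fin 3) :
    ∑ s, y s * aeval y (pderiv s (map (algebraMap (𝓞 k) k) (f i j))) =
      ((a i : AlgebraicClosure k) + a j + e) * aeval y (map (algebraMap (𝓞 k) k) (f i j)) := by
  obtain ⟨-, hhom, hneg⟩ := hf i j
  rcases lt_or_ge (a i + a j + e) 0 with h | h
  · simp [hneg h]
  · have := congrArg (aeval y) (hhom.map (algebraMap (𝓞 k) k)).sum_X_mul_pderiv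
    simp only [map_sum, map_mul, aeval_X, nsmul_eq_mul, map_natCast] at this
    rw [this]
    congr 1
    have h2 := congrArg (Int.cast (R := AlgebraicClosure k)) (Int.toNat_of_nonneg h)
    push_cast at h2
    exact_mod_cast h2

end Smooth

/-- On a smooth conic bundle over `ℙ¹`, no fibre is a double line. -/
lemma eq_zero_of_minors_eq_zero {a : Fin 3 → ℤ} {e : ℤ}
    {f : Fin 3 → Fin 3 → MvPolynomial (Fin (1 + 1)) (𝓞 k)} (hf : DegOK a e f)
    (hsmooth : IsSmoothX f) (y : Fin (1 + 1) → AlgebraicClosure k)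
    (hM : ∀ i₀ i₁ j₀ j₁, i₀ ≠ i₁ → j₀ ≠ j₁ →
      aeval y (map (algebraMap (𝓞 k) k) (f i₀ j₀ * f i₁ j₁ - f i₀ j₁ * f i₁ j₀)) = 0) :
    y = 0 := by
  by_contra hy
  set F : Fin 3 → Fin 3 → AlgebraicClosure k :=
    fun i j => aeval y (map (algebraMap (𝓞 k) k) (f i j)) with hF
  set G : Fin (1 + 1) → Fin 3 → Fin 3 → AlgebraicClosure k :=
    fun s i j => aeval y (pderiv s (map (algebraMap (𝓞 k) k) (f i j))) with hG
  obtain ⟨r, hr⟩ := exists_row_of_minors_eq_zero F fun i₀ i₁ j₀ j₁ hi hj => by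
    simpa only [map_sub, map_mul] using hM i₀ i₁ j₀ j₁ hi hj
  obtain ⟨s, hs⟩ : ∃ s, y s ≠ 0 := by
    by_contra! h
    exact hy (funext h)
  obtain ⟨t, ht⟩ : ∃ t : Fin (1 + 1), ∀ u, u = s ∨ u = t := by
    fin_cases s
    · exact ⟨1, by decide⟩
    · exact ⟨0, by decide⟩
  obtain ⟨x, hx, hrx, hGx⟩ := exists_line_inter_conic r (G t)
  have hFx := hr x hrx
  have hQ : ∀ c : Fin 3 → AlgebraicClosure k, ∑ i, ∑ j, c i * (F i j * x i * x j) = 0 := by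
    intro c
    refine Finset.sum_eq_zero fun i _ => ?_
    calc ∑ j, c i * (F i j * x i * x j) = c i * x i * ∑ j, F i j * x j := by
          rw [Finset.mul_sum]; exact Finset.sum_congr rfl fun j _ => by ring
      _ = 0 := by rw [hFx, mul_zero]
  have hQ' : ∀ c : Fin 3 → AlgebraicClosure k, ∑ i, ∑ j, c j * (F i j * x i * x j) = 0 := by
    intro c
    rw [Finset.sum_comm, ← hQ c]
    refine Finset.sum_congr rfl fun i _ => Finset.sum_congr rfl fun j _ => ?_
    simp only [hF, (hf i j).1]
    ring
  have heuler : ∑ u, y u * ∑ i, ∑ j, G u i j * x i * x j = 0 := by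
    have h1 : ∑ u, y u * ∑ i, ∑ j, G u i j * x i * x j =
        ∑ i, ∑ j, (∑ u, y u * G u i j) * x i * x j := by
      simp only [Finset.mul_sum, Finset.sum_mul]
      rw [Finset.sum_comm]
      refine Finset.sum_congr rfl fun i _ => ?_
      rw [Finset.sum_comm]
      refine Finset.sum_congr rfl fun j _ => Finset.sum_congr rfl fun u _ => by ring
    have h2 : ∀ i j, (∑ u, y u * G u i j) * x i * x j =
        (a i : AlgebraicClosure k) * (F i j * x i * x j) + a j * (F i j * x i * x j) +
          e * (F i j * x i * x j) := by
      intro i j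
      rw [sum_mul_aeval_pderiv y hf i j]
      ring
    simp only [h1, h2, Finset.sum_add_distrib]
    rw [hQ fun i => (a i : AlgebraicClosure k), hQ' fun i => (a i : AlgebraicClosure k),
      hQ fun _ => (e : AlgebraicClosure k)]
    simp
  have hGs : ∑ i, ∑ j, G s i j * x i * x j = 0 := by
    rw [Finset.sum_eq_single s (fun u _ hu => by
      rw [(ht u).resolve_left hu, hGx, mul_zero]) (by simp)] at heuler
    exact (mul_eq_zero.mp heuler).resolve_left hs
  obtain ⟨w, hw⟩ := hsmooth y x hy hx (by
    rw [aeval_Qk]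
    simpa using hQ fun _ => 1)
  apply hw
  rcases w with u | i
  · rw [aeval_pderiv_inl_Qk]
    rcases ht u with rfl | rfl
    · exact hGs
    · exact hGx
  · rw [aeval_pderiv_inr_Qk y x (fun i j => (hf i j).1)]
    exact mul_eq_zero_of_right _ (hFx i)

/-- An ideal of `A[X]` whose zero locus over an algebraic closure of the fraction field is
contained in the origin contains a nonzero constant multiple of a power of each variable. -/
lemma exists_C_mul_X_pow_mem {A k K σ : Type*} [CommRing A] [IsDomain A] [Field k] [Field K]
    [Algebra A k] [IsFractionRing A k] [Algebra k K] [IsAlgClosed K] [Finite σ]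
    (J : Ideal (MvPolynomial σ A))
    (hJ : ∀ y : σ → K, (∀ p ∈ J, aeval y (map (algebraMap A k) p) = 0) → y = 0) (s : σ) :
    ∃ c : A, c ≠ 0 ∧ ∃ N : ℕ, C c * X s ^ N ∈ J := by
  let := algebraMvPolynomial (σ := σ) (R := A) (S := k)
  have hmem : (X s : MvPolynomial σ k) ∈
      (J.map (algebraMap (MvPolynomial σ A) (MvPolynomial σ k))).radical := by
    rw [← vanishingIdeal_zeroLocus_eq_radical (K := K), mem_vanishingIdeal_iff]
    intro y hy
    rw [hJ y fun p hp => hy _ (Ideal.mem_map_of_mem _ hp)]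
    simp
  obtain ⟨N, hN⟩ := hmem
  have := MvPolynomial.isLocalization (σ := σ) (nonZeroDivisors A) k
  obtain ⟨⟨⟨p, hp⟩, ⟨q, hq⟩⟩, h⟩ := (IsLocalization.mem_map_algebraMap_iff
    ((nonZeroDivisors A).map (C (σ := σ))) (MvPolynomial σ k)).mp hN
  obtain ⟨c, hc, rfl⟩ := hq
  refine ⟨c, nonZeroDivisors.ne_zero hc, N, ?_⟩
  have : p = C c * X s ^ N := by
    apply map_injective (algebraMap A k) (IsFractionRing.injective A k)
    simp only [algebraMap_def, map_C] at h
    simp [← h, mul_comm]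
  exact this ▸ hp

/-- Lemma 3.9 / `lem:minors_norm_bounded`: for a conic bundle
surface (`n = 1`), the norm of the ideal of `2×2` minors `Δ₀(y₀,y₁)` is bounded,
uniformly over all `(y₀,y₁) ∈ O_k² ∖ {0}` with `y₀O_k + y₁O_k ∈ 𝒞`. -/
theorem statement_12
    (k : Type) [Field k] [NumberField k]
    (a : Fin 3 → ℤ) (ha : a 0 ≤ a 1 ∧ a 1 ≤ a 2) (e : ℤ)
    (f : Fin 3 → Fin 3 → MvPolynomial (Fin (1 + 1)) (𝓞 k))
    (hf : DegOK a e f) (hsmooth : IsSmoothX f)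
    -- a fixed finite set of integral ideals representing the ideal classes of `k`:
    (𝒞 : Finset (Ideal (𝓞 k))) (h𝒞 : ∀ I ∈ 𝒞, I ≠ ⊥) :
    ∃ C : ℕ, 0 < C ∧
      ∀ z : Fin (1 + 1) → 𝓞 k, z ≠ 0 → Ideal.span (Set.range z) ∈ 𝒞 →
        minorsIdeal f z ≠ ⊥ ∧ Ideal.absNorm (minorsIdeal f z) ≤ C := by
  obtain ⟨c, hc, N, hN⟩ : ∃ c : 𝓞 k, c ≠ 0 ∧ ∃ N : ℕ, ∀ z : Fin (1 + 1) → 𝓞 k, ∀ s,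
      c * z s ^ N ∈ minorsIdeal f z := by
    let J : Ideal (MvPolynomial (Fin (1 + 1)) (𝓞 k)) :=
      Ideal.span {d | ∃ i₀ i₁ j₀ j₁ : Fin 3, i₀ ≠ i₁ ∧ j₀ ≠ j₁ ∧
        d = f i₀ j₀ * f i₁ j₁ - f i₀ j₁ * f i₁ j₀}
    have hJeval : ∀ z : Fin (1 + 1) → 𝓞 k, ∀ p ∈ J, eval z p ∈ minorsIdeal f z := by
      intro z p hp
      suffices J ≤ (minorsIdeal f z).comap (eval z) from this hp
      refine Ideal.span_le.mpr ?_
      rintro _ ⟨i₀, i₁, j₀, j₁, hi, hj, rfl⟩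
      exact Ideal.subset_span ⟨i₀, i₁, j₀, j₁, hi, hj, by simp⟩
    have hJ : ∀ y : Fin (1 + 1) → AlgebraicClosure k,
        (∀ p ∈ J, aeval y (map (algebraMap (𝓞 k) k) p) = 0) → y = 0 := fun y hy =>
      eq_zero_of_minors_eq_zero hf hsmooth y fun i₀ i₁ j₀ j₁ hi hj =>
        hy _ (Ideal.subset_span ⟨i₀, i₁, j₀, j₁, hi, hj, rfl⟩)
    choose c hc N hN using exists_C_mul_X_pow_mem J hJ
    refine ⟨∏ s, c s, Finset.prod_ne_zero_iff.mpr fun s _ => hc s, ∑ s, N s, fun z s => ?_⟩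
    have h1 := hJeval z _ (hN s)
    simp only [map_mul, map_pow, eval_C, eval_X] at h1
    refine Ideal.mem_of_dvd _ (mul_dvd_mul (Finset.dvd_prod_of_mem c (Finset.mem_univ s))
      (pow_dvd_pow _ ?_)) h1
    exact Finset.single_le_sum (f := N) (fun _ _ => Nat.zero_le _) (Finset.mem_univ s)
  have hle : ∀ z : Fin (1 + 1) → 𝓞 k,
      Ideal.span {c} * Ideal.span (Set.range z) ^ (N + N) ≤ minorsIdeal f z := by
    intro z
    have hrange : Ideal.span (Set.range z) = Ideal.span {z 0} ⊔ Ideal.span {z 1} := by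
      rw [← Ideal.span_union]
      congr 1
      ext w
      simp [Fin.exists_fin_two, eq_comm, or_comm]
    rw [hrange]
    refine (Ideal.mul_mono_right Ideal.sup_pow_add_le_pow_sup_pow).trans ?_
    rw [Ideal.mul_sup, Ideal.span_singleton_pow, Ideal.span_singleton_pow,
      Ideal.span_singleton_mul_span_singleton, Ideal.span_singleton_mul_span_singleton,
      sup_le_iff, Ideal.span_singleton_le_iff_mem, Ideal.span_singleton_le_iff_mem]
    exact ⟨hN z 0, hN z 1⟩
  let b : Ideal (𝓞 k) → ℕ := fun I => Ideal.absNorm (Ideal.span {c} * I ^ (N + N))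
  refine ⟨∑ I ∈ 𝒞, b I + 1, Nat.succ_pos _, fun z _ hzC => ?_⟩
  have hne : Ideal.span {c} * Ideal.span (Set.range z) ^ (N + N) ≠ ⊥ :=
    mul_ne_zero (by simpa using hc) (pow_ne_zero _ (h𝒞 _ hzC))
  refine ⟨fun h => hne (le_bot_iff.mp (h ▸ hle z)), ?_⟩
  have h1 : Ideal.absNorm (minorsIdeal f z) ≤ b (Ideal.span (Set.range z)) :=
    Nat.le_of_dvd
      (Nat.pos_of_ne_zero (by simpa only [b, ne_eq, Ideal.absNorm_eq_zero_iff] using hne))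
      (Ideal.absNorm_dvd_absNorm_of_le (hle z))
  have h2 := Finset.single_le_sum (f := b) (fun _ _ => Nat.zero_le _) hzC
  omega

end Stmt
end
end
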